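/- (Main averaging theorem, finite horizon.) Fix u_m > 0 and let w, M(u,σ), s₀, s₁ be the PWM sawtooth, modulation function, probing signal and its zero-mean primitive defined from u_m as in the paper. Let f, g : ℝⁿ → ℝⁿ and h : ℝⁿ → ℝ be bounded and C³ with bounded derivatives; let α : ℝ^q × ℝ² × ℝ → ℝ and a : ℝ^q × ℝ² × ℝ → ℝ^q be bounded and C² with bounded derivatives, with |α| ≤ u_m − δ for some δ > 0. For ε > 0 define H(x) := (h(x), ε·h'(x)g(x)) ∈ ℝ² and H̄(x, η, σ, t) := H(x − ε·g(x)·s₁(α(η, H(x), t), σ)). Fix L > 0, x₀ ∈ ℝⁿ, η₀ ∈ ℝ^q. Let (x(t), η(t)), t ∈ [0, L], be an absolutely continuous solution of the PWM closed loop ẋ(t) = f(x(t)) + g(x(t))·M(α(η(t), H̄(x(t), η(t), t/ε, t), t), t/ε), η̇(t) = a(η(t), H̄(x(t), η(t), t/ε, t), t) (almost everywhere) with (x(0), η(0)) = (x₀, η₀); set u(t) := α(η(t), H(x(t)), t) and y(t) := h(x(t)). Let (x̄(t), η̄(t)) be the solution of the averaged closed loop x̄' = f(x̄) + g(x̄)·α(η̄,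 H(x̄), t), η̄' = a(η̄, H(x̄), t) with x̄(0) = x₀ − ε·g(x₀)·s₁(u(0), 0), η̄(0) = η₀; set ū(t) := α(η̄(t), H(x̄(t)), t). Then there exist K > 0 and ε₀ > 0, independent of ε and t, such that for all ε ∈ (0, ε₀) and all t ∈ [0, L]: ‖x(t) − x̄(t) − ε·g(x̄(t))·s₁(ū(t), t/ε)‖ ≤ K·ε², ‖η(t) − η̄(t)‖ ≤ K·ε², and |y(t) − h(x̄(t)) − ε·h'(x̄(t))·g(x̄(t))·s₁(ū(t), t/ε)| ≤ K·ε². -/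

import Mathlib

open MeasureTheory
namespace PWM
noncomputable section

/-- sawtooth -/
def ww (um σ : ℝ) : ℝ := um * Int.fract (σ + 1/2) - um/2
/-- modulation -/
def MM (um v σ : ℝ) : ℝ :=
  um + um * Real.sign (v - um - 4 * ww um σ) + um * Real.sign (v - um + 4 * ww um σ)
/-- primitive -/
def SS (um v σ : ℝ) : ℝ :=
  (1 - v/um) * ww um σ - |(v - um)/4 - ww um σ| + |(v - um)/4 + ww um σ|

lemma ww_add_nat (um σ : ℝ) (k : ℕ) : ww um (k + σ) = ww um σ := by
  unfold ww
  rw [show (k:ℝ) + σ + 1/2 = (σ + 1/2) + (k:ℝ) by ring, Int.fract_add_natCast]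

lemma MM_add_nat (um v σ : ℝ) (k : ℕ) : MM um v (k + σ) = MM um v σ := by
  simp only [MM, ww_add_nat]

lemma SS_add_nat (um v σ : ℝ) (k : ℕ) : SS um v (k + σ) = SS um v σ := by
  simp only [SS, ww_add_nat]

lemma ww_left {um σ : ℝ} (h0 : 0 ≤ σ) (h1 : σ < 1/2) : ww um σ = um * σ := by
  unfold ww
  rw [Int.fract_eq_self.2 ⟨by linarith, by linarith⟩]; ring

lemma ww_right {um σ : ℝ} (h0 : 1/2 ≤ σ) (h1 : σ ≤ 1) : ww um σ = um * (σ - 1) := by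
  unfold ww
  rw [show σ + 1/2 = (σ - 1/2) + 1 by ring, Int.fract_add_one,
    Int.fract_eq_self.2 ⟨by linarith, by linarith⟩]; ring

lemma abs_ww_le {um : ℝ} (hum : 0 < um) (σ : ℝ) : |ww um σ| ≤ um / 2 := by
  unfold ww
  have h1 := Int.fract_nonneg (σ + 1/2)
  have h2 := (Int.fract_lt_one (σ + 1/2)).le
  rw [abs_le]; constructor <;> nlinarith

lemma abs_sign_le (x : ℝ) : |Real.sign x| ≤ 1 := by
  rcases lt_trichotomy x 0 with h | h | h
  · rw [Real.sign_of_neg h]; norm_num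
  · subst h; simp
  · rw [Real.sign_of_pos h]; norm_num

lemma abs_MM_le {um : ℝ} (hum : 0 < um) (v σ : ℝ) : |MM um v σ| ≤ 3 * um := by
  unfold MM
  have h1 := abs_le.1 (abs_sign_le (v - um - 4 * ww um σ))
  have h2 := abs_le.1 (abs_sign_le (v - um + 4 * ww um σ))
  rw [abs_le]; constructor <;> nlinarith [h1.1, h1.2, h2.1, h2.2]

lemma abs_SS_le {um v : ℝ} (hum : 0 < um) (hv : |v| ≤ um) (σ : ℝ) : |SS um v σ| ≤ 2 * um := by
  unfold SS
  have hw := abs_ww_le hum σ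
  have h1 : |1 - v/um| ≤ 2 := by
    have : |v/um| ≤ 1 := by
      rw [abs_div, abs_of_pos hum, div_le_one hum]; exact hv
    have := abs_le.1 this
    rw [abs_le]; constructor <;> linarith
  have h2 : |(1 - v/um) * ww um σ| ≤ um := by
    rw [abs_mul]
    calc _ ≤ 2 * (um/2) := by gcongr
      _ = um := by ring
  have h3 : |(v - um)/4 - ww um σ| ≤ |(v - um)/4 + ww um σ| + 2 * |ww um σ| := by
    have := abs_sub_abs_le_abs_sub ((v - um)/4 - ww um σ) ((v - um)/4 + ww um σ)
    rw [show (v - um)/4 - ww um σ - ((v - um)/4 + ww um σ) = -(2 * ww um σ) by ring, abs_neg,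
      abs_mul, abs_two] at this
    linarith
  have h4 : |(v - um)/4 + ww um σ| ≤ |(v - um)/4 - ww um σ| + 2 * |ww um σ| := by
    have := abs_sub_abs_le_abs_sub ((v - um)/4 + ww um σ) ((v - um)/4 - ww um σ)
    rw [show (v - um)/4 + ww um σ - ((v - um)/4 - ww um σ) = (2 * ww um σ) by ring,
      abs_mul, abs_two] at this
    linarith
  have h2' := abs_le.1 h2
  rw [abs_le]; constructor <;> linarith [h2'.1, h2'.2]

lemma SS_lip {um : ℝ} (hum : 0 < um) (v v' σ : ℝ) : |SS um v σ - SS um v' σ| ≤ |v - v'| := by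
  unfold SS
  have hw := abs_ww_le hum σ
  have h2 : |(v' - v)/um * ww um σ| ≤ |v - v'| / 2 := by
    rw [abs_mul, abs_div, abs_of_pos hum, abs_sub_comm v' v]
    calc _ ≤ |v - v'| / um * (um/2) := by gcongr
      _ = _ := by field_simp
  have e : |(v - v')/4| = |v - v'|/4 := by rw [abs_div]; norm_num
  have h3 := abs_abs_sub_abs_le ((v - um)/4 - ww um σ) ((v' - um)/4 - ww um σ)
  have h4 := abs_abs_sub_abs_le ((v - um)/4 + ww um σ) ((v' - um)/4 + ww um σ)
  rw [show (v - um)/4 - ww um σ - ((v' - um)/4 - ww um σ) = (v - v')/4 by ring, e] at h3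
  rw [show (v - um)/4 + ww um σ - ((v' - um)/4 + ww um σ) = (v - v')/4 by ring, e] at h4
  have h2' := abs_le.1 h2
  have h3' := abs_le.1 h3
  have h4' := abs_le.1 h4
  have e5 : (1 - v/um) * ww um σ = (1 - v'/um) * ww um σ + (v' - v)/um * ww um σ := by ring
  rw [e5, abs_le]; constructor <;> linarith [h2'.1, h2'.2, h3'.1, h3'.2, h4'.1, h4'.2]

lemma SS_zero (um v : ℝ) : SS um v 0 = 0 := by
  unfold SS
  rw [ww_left le_rfl (by norm_num)]; simp

lemma SS_one (um v : ℝ) : SS um v 1 = 0 := by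
  unfold SS
  rw [ww_right (by norm_num) le_rfl]; simp

lemma SS_half {um v : ℝ} (hum : 0 < um) (hv : |v| ≤ um) : SS um v (1/2) = 0 := by
  unfold SS
  have hv := abs_le.1 hv
  rw [ww_right le_rfl (by norm_num), abs_of_nonneg (by linarith), abs_of_nonpos (by linarith)]
  field_simp; ring

lemma measurable_sign : Measurable Real.sign := by
  unfold Real.sign
  exact Measurable.ite measurableSet_Iio measurable_const
    (Measurable.ite measurableSet_Ioi measurable_const measurable_const)

lemma measurable_ww (um : ℝ) : Measurable (ww um) := by
  unfold ww
  exact (((measurable_id.add_const _).fract).const_mul _).sub_const _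

lemma measurable_MM (um : ℝ) {v s : ℝ → ℝ} (hv : Measurable v) (hs : Measurable s) :
    Measurable fun r => MM um (v r) (s r) := by
  unfold MM
  have hw := (measurable_ww um).comp hs
  have h1 := measurable_sign.comp ((hv.sub_const um).sub (hw.const_mul 4))
  have h2 := measurable_sign.comp ((hv.sub_const um).add (hw.const_mul 4))
  exact ((h1.const_mul um).const_add um).add (h2.const_mul um)

lemma measurable_SS (um : ℝ) {v s : ℝ → ℝ} (hv : Measurable v) (hs : Measurable s) :
    Measurable fun r => SS um (v r) (s r) := by
  unfold SS
  have hw := (measurable_ww um).comp hs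
  have h0 := (hv.sub_const um).div_const 4
  have h1 := (h0.sub hw).abs
  have h2 := (h0.add hw).abs
  exact ((((hv.div_const um).const_sub 1).mul hw).sub h1).add h2

lemma ww_refl {um r : ℝ} (h0 : 0 ≤ r) (h1 : r ≤ 1) (h : r ≠ 1/2) : ww um (1 - r) = - ww um r := by
  rcases lt_or_gt_of_ne h with h | h
  · rw [ww_right (by linarith) (by linarith), ww_left h0 h]; ring
  · rw [ww_left (by linarith) (by linarith), ww_right h.le h1]; ring

lemma MM_refl {um v r : ℝ} (h0 : 0 ≤ r) (h1 : r ≤ 1) : MM um v (1 - r) = MM um v r := by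
  by_cases h : r = 1/2
  · subst h; norm_num
  · unfold MM; rw [ww_refl h0 h1 h]; ring_nf

lemma SS_refl {um v r : ℝ} (hum : 0 < um) (hv : |v| ≤ um) (h0 : 0 ≤ r) (h1 : r ≤ 1) :
    SS um v (1 - r) = - SS um v r := by
  by_cases h : r = 1/2
  · subst h
    rw [show (1:ℝ) - 1/2 = 1/2 by norm_num, SS_half hum hv]; simp
  · unfold SS; rw [ww_refl h0 h1 h]; ring_nf

/-- bounded measurable functions are interval integrable -/
lemma ii_of_bdd {E : Type*} [NormedAddCommGroup E] {φ : ℝ → E} (hφ : StronglyMeasurable φ)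
    {B a b : ℝ} (hab : a ≤ b) (hB : ∀ r ∈ Set.Icc a b, ‖φ r‖ ≤ B) :
    IntervalIntegrable φ volume a b := by
  refine (intervalIntegrable_iff_integrableOn_Ioc_of_le hab).2 ?_
  refine Measure.integrableOn_of_bounded (M := B) (by simp) hφ.aestronglyMeasurable ?_
  exact (ae_restrict_iff' measurableSet_Ioc).2 (ae_of_all _ fun r hr => hB r ⟨hr.1.le, hr.2⟩)

lemma odd_int {φ : ℝ → ℝ} (h : ∀ r ∈ Set.Icc (0:ℝ) 1, φ (1 - r) = - φ r) :
    ∫ r in (0:ℝ)..1, φ r = 0 := by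
  have h1 : ∫ r in (0:ℝ)..1, φ (1 - r) = ∫ r in (0:ℝ)..1, φ r := by
    rw [intervalIntegral.integral_comp_sub_left φ 1]; norm_num
  have h2 : ∫ r in (0:ℝ)..1, φ (1 - r) = ∫ r in (0:ℝ)..1, - φ r := by
    refine intervalIntegral.integral_congr fun r hr => ?_
    rw [Set.uIcc_of_le zero_le_one] at hr
    exact h r hr
  rw [intervalIntegral.integral_neg] at h2
  linarith

lemma int_step {a s : ℝ} (ha : 0 ≤ a) (hs : 0 ≤ s) :
    IntervalIntegrable (fun r : ℝ => if a < r then (1:ℝ) else 0) volume 0 s ∧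
    ∫ r in (0:ℝ)..s, (if a < r then (1:ℝ) else 0) = max (s - a) 0 := by
  have hm : Measurable (fun r : ℝ => if a < r then (1:ℝ) else 0) :=
    Measurable.ite measurableSet_Ioi measurable_const measurable_const
  have hI : ∀ x y : ℝ, x ≤ y → IntervalIntegrable (fun r : ℝ => if a < r then (1:ℝ) else 0) volume x y :=
    fun x y hxy => ii_of_bdd hm.stronglyMeasurable hxy (B := 1) fun r _ => by split_ifs <;> simp
  refine ⟨hI 0 s hs, ?_⟩
  rcases le_total s a with h | h
  · rw [max_eq_right (by linarith)]
    rw [intervalIntegral.integral_congr (g := fun _ => (0:ℝ))]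
    · simp
    · intro r hr
      rw [Set.uIcc_of_le hs] at hr
      exact if_neg (not_lt.2 (hr.2.trans h))
  · rw [max_eq_left (by linarith), ← intervalIntegral.integral_add_adjacent_intervals (hI 0 a ha) (hI a s h)]
    have e1 : ∫ r in (0:ℝ)..a, (if a < r then (1:ℝ) else 0) = 0 := by
      rw [intervalIntegral.integral_congr (g := fun _ => (0:ℝ))]
      · simp
      · intro r hr
        rw [Set.uIcc_of_le ha] at hr
        exact if_neg (not_lt.2 hr.2)
    have e2 : ∫ r in a..s, (if a < r then (1:ℝ) else 0) = s - a := by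
      rw [intervalIntegral.integral_congr_ae (g := fun _ => (1:ℝ))]
      · simp
      · refine ae_of_all _ fun r hr => ?_
        rw [Set.uIoc_of_le h] at hr
        exact if_pos hr.1
    rw [e1, e2]; ring

lemma int_MM_aff {um δ v κ s : ℝ} (hδ : 0 ≤ δ) (hum : 0 < um) (hv : |v| ≤ um - δ)
    (hκ : |κ| ≤ δ) (hs0 : 0 ≤ s) (hs1 : s ≤ 1) :
    ∫ r in (0:ℝ)..s, MM um (v + κ * r) r =
      - um * s + 2 * um * (max (s - (um - v)/(4*um + κ)) 0 - max (s - (3*um + v)/(4*um - κ)) 0) := by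
  have hv := abs_le.1 hv
  have hκ := abs_le.1 hκ
  have hp : 0 < 4*um + κ := by linarith
  have hm : 0 < 4*um - κ := by linarith
  set a := (um - v)/(4*um + κ) with ha
  set b := (3*um + v)/(4*um - κ) with hb
  have ha0 : 0 ≤ a := div_nonneg (by linarith) hp.le
  have ha1 : a ≤ 1/2 := by rw [ha, div_le_iff₀ hp]; linarith
  have hb0 : 1/2 ≤ b := by rw [hb, le_div_iff₀ hm]; linarith
  have hae : a * (4*um + κ) = um - v := div_mul_cancel₀ _ hp.ne'
  have hbe : b * (4*um - κ) = 3*um + v := div_mul_cancel₀ _ hm.ne'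
  have hne : ∀ᵐ r : ℝ, r ≠ a ∧ r ≠ b ∧ r ≠ 1/2 ∧ r ≠ 1 := by
    have : ∀ c : ℝ, ∀ᵐ r : ℝ, r ≠ c := fun c => by
      simp [ae_iff]
    filter_upwards [this a, this b, this (1/2), this 1] with r h1 h2 h3 h4 using ⟨h1, h2, h3, h4⟩
  have key : ∫ r in (0:ℝ)..s, MM um (v + κ * r) r =
      ∫ r in (0:ℝ)..s, (- um + 2 * um * ((if a < r then (1:ℝ) else 0) - (if b < r then (1:ℝ) else 0))) := by
    refine intervalIntegral.integral_congr_ae ?_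
    filter_upwards [hne] with r hr hrs
    rw [Set.uIoc_of_le hs0] at hrs
    obtain ⟨hr0, hrs⟩ := hrs
    obtain ⟨h1, h2, h3, h4⟩ := hr
    unfold MM
    rcases lt_or_gt_of_ne h3 with h | h
    · rw [ww_left hr0.le h, if_neg (show ¬ b < r by linarith)]
      have s1 : v + κ * r - um - 4 * (um * r) < 0 := by
        by_contra! hc
        nlinarith
      rw [Real.sign_of_neg s1]
      rcases lt_or_gt_of_ne h1 with h' | h'
      · rw [if_neg (show ¬ a < r by linarith), Real.sign_of_neg (by nlinarith)]; ring
      · rw [if_pos h', Real.sign_of_pos (by nlinarith)]; ring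
    · have hr1 : r ≤ 1 := hrs.trans hs1
      rw [ww_right h.le hr1, if_pos (show a < r by linarith)]
      have s1 : v + κ * r - um + 4 * (um * (r - 1)) < 0 := by
        have h'' := lt_of_le_of_ne hr1 h4
        nlinarith
      rw [Real.sign_of_neg s1]
      rcases lt_or_gt_of_ne h2 with h' | h'
      · rw [if_neg (show ¬ b < r by linarith), Real.sign_of_pos (by nlinarith)]; ring
      · rw [if_pos h', Real.sign_of_neg (by nlinarith)]; ring
  obtain ⟨i1, e1⟩ := int_step ha0 hs0
  obtain ⟨i2, e2⟩ := int_step (show 0 ≤ b by linarith) hs0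
  rw [key, intervalIntegral.integral_add (by simp) ((i1.sub i2).const_mul _),
    intervalIntegral.integral_const_mul, intervalIntegral.integral_sub i1 i2, e1, e2]
  simp; ring

lemma int_MM {um v s : ℝ} (hum : 0 < um) (hv : |v| ≤ um) (hs0 : 0 ≤ s) (hs1 : s ≤ 1) :
    ∫ r in (0:ℝ)..s, MM um v r = v * s + SS um v s := by
  have h := int_MM_aff (δ := 0) (κ := 0) le_rfl hum (by simpa using hv) (by simp) hs0 hs1
  simp only [zero_mul, add_zero, sub_zero] at h
  rw [h]
  have hv := abs_le.1 hv
  have e1 : (um - v)/(4*um) = 1/4 - v/um/4 := by field_simp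
  have e2 : (3*um + v)/(4*um) = 3/4 + v/um/4 := by field_simp
  set y := v/um with hy
  have hvy : v = um * y := by rw [hy]; field_simp
  have hy1 : -1 ≤ y := by rw [hy, le_div_iff₀ hum]; linarith
  have hy2 : y ≤ 1 := by rw [hy, div_le_iff₀ hum]; linarith
  rw [e1, e2]
  unfold SS
  rw [← hy, hvy]
  rcases lt_or_ge s (1/2) with h | h
  · rw [ww_left hs0 h, max_eq_right (a := s - (3/4 + y/4)) (by linarith)]
    rw [abs_of_nonpos (a := (um * y - um)/4 - um * s) (by nlinarith)]
    rcases le_total s (1/4 - y/4) with h' | h'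
    · rw [max_eq_right (by linarith), abs_of_nonpos (by nlinarith)]; ring
    · rw [max_eq_left (by linarith), abs_of_nonneg (by nlinarith)]; ring
  · rw [ww_right h hs1, max_eq_left (a := s - (1/4 - y/4)) (by linarith)]
    rw [abs_of_nonpos (a := (um * y - um)/4 + um * (s - 1)) (by nlinarith)]
    rcases le_total s (3/4 + y/4) with h' | h'
    · rw [max_eq_right (by linarith), abs_of_nonneg (by nlinarith)]; ring
    · rw [max_eq_left (by linarith), abs_of_nonpos (by nlinarith)]; ring

lemma ii_MM {um : ℝ} (hum : 0 < um) {V : ℝ → ℝ} (hV : Measurable V) {a b : ℝ} (hab : a ≤ b) :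
    IntervalIntegrable (fun r => MM um (V r) r) volume a b :=
  ii_of_bdd (measurable_MM um hV measurable_id).stronglyMeasurable hab
    fun r _ => abs_MM_le hum _ _

lemma ii_SS {um : ℝ} (hum : 0 < um) {v : ℝ} (hv : |v| ≤ um) {a b : ℝ} (hab : a ≤ b) :
    IntervalIntegrable (fun r => SS um v r) volume a b :=
  ii_of_bdd (measurable_SS um measurable_const measurable_id).stronglyMeasurable hab
    fun r _ => abs_SS_le hum hv _

lemma int_SS {um v : ℝ} (hum : 0 < um) (hv : |v| ≤ um) : ∫ r in (0:ℝ)..1, SS um v r = 0 :=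
  odd_int fun _ hr => SS_refl hum hv hr.1 hr.2

lemma int_s0_SS {um v : ℝ} (hum : 0 < um) (hv : |v| ≤ um) :
    ∫ r in (0:ℝ)..1, (MM um v r - v) * SS um v r = 0 :=
  odd_int fun r hr => by rw [SS_refl hum hv hr.1 hr.2, MM_refl hr.1 hr.2]; ring

lemma int_s0_id {um v : ℝ} (hum : 0 < um) (hv : |v| ≤ um) :
    ∫ r in (0:ℝ)..1, (MM um v r - v) * r = 0 := by
  have h1 : ∫ r in (0:ℝ)..1, (MM um v r - v) * (r - 1/2) = 0 :=
    odd_int fun r hr => by rw [MM_refl hr.1 hr.2]; ring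
  have iM := ii_MM hum (measurable_const (a := v)) (zero_le_one (α := ℝ))
  have h0 : ∫ r in (0:ℝ)..1, (MM um v r - v) = 0 := by
    rw [intervalIntegral.integral_sub iM (by simp), int_MM hum hv zero_le_one le_rfl, SS_one]
    simp
  have i2 : IntervalIntegrable (fun r => (MM um v r - v) * (r - 1/2)) volume 0 1 :=
    (iM.sub (by simp)).mul_continuousOn (by fun_prop)
  have i3 : IntervalIntegrable (fun r => (MM um v r - v) * (1/2)) volume 0 1 :=
    (iM.sub (by simp)).mul_const _
  have : ∫ r in (0:ℝ)..1, (MM um v r - v) * r =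
      ∫ r in (0:ℝ)..1, ((MM um v r - v) * (r - 1/2) + (MM um v r - v) * (1/2)) := by
    congr 1; ext r; ring
  rw [this, intervalIntegral.integral_add i2 i3, h1, intervalIntegral.integral_mul_const, h0]
  simp

lemma int_MM_aff_approx {um δ v κ : ℝ} (hδ : 0 ≤ δ) (hum : 0 < um) (hv : |v| ≤ um - δ)
    (hκ : |κ| ≤ δ) :
    |(∫ r in (0:ℝ)..1, MM um (v + κ * r) r) - (v + κ/2)| ≤ 4 / um * κ^2 := by
  rw [int_MM_aff hδ hum hv hκ zero_le_one le_rfl]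
  have hv := abs_le.1 hv
  have hκ := abs_le.1 hκ
  have hp : 0 < 4*um + κ := by linarith
  have hm : 0 < 4*um - κ := by linarith
  have hb1 : (um - v)/(4*um + κ) ≤ 1 := by rw [div_le_iff₀ hp]; linarith
  have hb2 : (3*um + v)/(4*um - κ) ≤ 1 := by rw [div_le_iff₀ hm]; linarith
  rw [max_eq_left (by linarith), max_eq_left (by linarith)]
  have e : -um * 1 + 2 * um * (1 - (um - v) / (4 * um + κ) - (1 - (3 * um + v) / (4 * um - κ))) -
      (v + κ / 2) = κ^2 * ((2 * um + 2 * v + κ) / (2 * ((4 * um + κ) * (4 * um - κ)))) := by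
    have hp' := hp.ne'
    have hm' := hm.ne'
    generalize hA : 4 * um + κ = A at *
    generalize hB : 4 * um - κ = B at *
    have e1 : um = (A + B)/8 := by linarith
    have e2 : κ = (A - B)/2 := by linarith
    field_simp
    rw [e1, e2]; ring
  rw [e, abs_mul, abs_of_nonneg (sq_nonneg κ), mul_comm]
  gcongr
  have hpm : 9 * um^2 ≤ (4 * um + κ) * (4 * um - κ) := by nlinarith
  rw [abs_div, abs_of_pos (a := 2 * _) (by positivity), div_le_div_iff₀ (by positivity) hum]
  have : |2 * um + 2 * v + κ| ≤ 5 * um := by rw [abs_le]; constructor <;> linarith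
  nlinarith [mul_le_mul_of_nonneg_right this hum.le]

lemma sign_diff {p q ρ : ℝ} (h : |p - q| ≤ ρ) :
    |Real.sign p - Real.sign q| ≤ 2 * (if |q| ≤ ρ then 1 else 0) := by
  split_ifs with hq
  · have h1 := abs_le.1 (abs_sign_le p)
    have h2 := abs_le.1 (abs_sign_le q)
    rw [abs_le]; constructor <;> linarith [h1.1, h1.2, h2.1, h2.2]
  · push Not at hq
    have h := abs_le.1 h
    rcases lt_abs.1 hq with h' | h'
    · rw [Real.sign_of_pos (r := p) (by linarith), Real.sign_of_pos (r := q) (by linarith [abs_nonneg (p-q)])]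
      simp
    · rw [Real.sign_of_neg (r := p) (by linarith), Real.sign_of_neg (r := q) (by linarith)]
      simp

/-- indicator of the set where an affine function is small -/
def ind (b m ρ r : ℝ) : ℝ := if |b + m * r| ≤ ρ then 1 else 0

lemma ind_nonneg (b m ρ r : ℝ) : 0 ≤ ind b m ρ r := by
  unfold ind; split_ifs <;> simp

lemma ii_ind (b m ρ : ℝ) {s : ℝ} (hs : 0 ≤ s) :
    IntervalIntegrable (ind b m ρ) volume 0 s := by
  have hm : Measurable (ind b m ρ) :=
    Measurable.ite (measurableSet_le (by fun_prop) measurable_const) measurable_const measurable_const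
  refine ii_of_bdd hm.stronglyMeasurable hs (B := 1) fun r _ => ?_
  unfold ind; split_ifs <;> simp

lemma int_ind {b m ρ c s : ℝ} (hρ : 0 ≤ ρ) (hc : 0 < c) (hm : c ≤ |m|) (hs : 0 ≤ s) :
    ∫ r in (0:ℝ)..s, ind b m ρ r ≤ 2 * ρ / c := by
  have hm0 : m ≠ 0 := by intro h; rw [h] at hm; simp at hm; linarith
  have e : ind b m ρ = (Metric.closedBall (-b/m) (ρ/|m|)).indicator (fun _ => (1:ℝ)) := by
    classical
    ext r
    unfold ind
    rw [Set.indicator_apply]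
    congr 1
    rw [Metric.mem_closedBall, Real.dist_eq, le_div_iff₀ (abs_pos.2 hm0), ← abs_mul]
    have : (r - -b / m) * m = b + m * r := by field_simp; ring
    rw [this]
  rw [intervalIntegral.integral_of_le hs, e]
  have hi : Integrable ((Metric.closedBall (-b/m) (ρ/|m|)).indicator (fun _ => (1:ℝ))) volume := by
    refine (integrable_indicator_iff Metric.isClosed_closedBall.measurableSet).2 ?_
    exact integrableOn_const (by rw [Real.volume_closedBall]; exact ENNReal.ofReal_ne_top)
  calc ∫ r in Set.Ioc 0 s, (Metric.closedBall (-b/m) (ρ/|m|)).indicator (fun _ => (1:ℝ)) r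
      ≤ ∫ r, (Metric.closedBall (-b/m) (ρ/|m|)).indicator (fun _ => (1:ℝ)) r :=
        setIntegral_le_integral hi (ae_of_all _ fun r => Set.indicator_nonneg (fun _ _ => zero_le_one) r)
    _ = 2 * (ρ / |m|) := by
        rw [integral_indicator Metric.isClosed_closedBall.measurableSet]
        simp [Real.volume_real_closedBall (div_nonneg hρ (abs_nonneg m))]
    _ ≤ 2 * ρ / c := by
        rw [← mul_div_assoc]; gcongr

/-- L¹-Lipschitz estimate for the modulation around an affine reference -/
lemma int_MM_diff {um v κ ρ s : ℝ} (hum : 0 < um) (hκ : |κ| ≤ um) (hρ : 0 ≤ ρ)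
    (hs0 : 0 ≤ s) (hs1 : s ≤ 1) {V : ℝ → ℝ} (hV : Measurable V)
    (h : ∀ r ∈ Set.Icc 0 s, |V r - (v + κ * r)| ≤ ρ) :
    ∫ r in (0:ℝ)..s, |MM um (V r) r - MM um (v + κ * r) r| ≤ 6 * ρ := by
  have i0 : IntervalIntegrable (fun r => |MM um (V r) r - MM um (v + κ * r) r|) volume 0 s :=
    ((ii_MM hum hV hs0).sub (ii_MM hum (V := fun r => v + κ * r) (by fun_prop) hs0)).abs
  have hκ := abs_le.1 hκ
  have hm1 : 3 * um ≤ |κ - 4 * um| := by rw [abs_of_nonpos] <;> linarith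
  have hm2 : 3 * um ≤ |κ + 4 * um| := by rw [abs_of_nonneg] <;> linarith
  let J : ℝ → ℝ := fun r => 2 * um * ((ind (v - um) (κ - 4*um) ρ r + ind (v - um) (κ + 4*um) ρ r)
    + (ind (v + 3*um) (κ - 4*um) ρ r + ind (v - 5*um) (κ + 4*um) ρ r))
  have h3 : 0 < 3 * um := by linarith
  have i1 := ii_ind (v - um) (κ - 4*um) ρ hs0
  have i2 := ii_ind (v - um) (κ + 4*um) ρ hs0
  have i3 := ii_ind (v + 3*um) (κ - 4*um) ρ hs0
  have i4 := ii_ind (v - 5*um) (κ + 4*um) ρ hs0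
  have iJ : IntervalIntegrable J volume 0 s := ((i1.add i2).add (i3.add i4)).const_mul _
  have hJ : ∫ r in (0:ℝ)..s, J r ≤ 6 * ρ := by
    have : ∫ r in (0:ℝ)..s, J r ≤ 2 * um * ((2 * ρ / (3*um) + 2 * ρ / (3*um)) + (2 * ρ / (3*um) + 2 * ρ / (3*um))) := by
      simp only [J]
      rw [intervalIntegral.integral_const_mul, intervalIntegral.integral_add (i1.add i2) (i3.add i4),
        intervalIntegral.integral_add i1 i2, intervalIntegral.integral_add i3 i4]
      gcongr <;> apply int_ind <;> assumption
    refine this.trans ?_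
    have : 2 * um * ((2 * ρ / (3*um) + 2 * ρ / (3*um)) + (2 * ρ / (3*um) + 2 * ρ / (3*um))) = 16/3 * ρ := by
      field_simp; ring
    linarith
  refine le_trans (intervalIntegral.integral_mono_on hs0 i0 iJ fun r hr => ?_) hJ
  have hr1 := hr.2.trans hs1
  have hVr := h r hr
  have d1 := sign_diff (p := V r - um - 4 * ww um r) (q := v + κ * r - um - 4 * ww um r) (ρ := ρ)
    (by rw [show V r - um - 4 * ww um r - (v + κ * r - um - 4 * ww um r) = V r - (v + κ * r) by ring]; exact hVr)
  have d2 := sign_diff (p := V r - um + 4 * ww um r) (q := v + κ * r - um + 4 * ww um r) (ρ := ρ)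
    (by rw [show V r - um + 4 * ww um r - (v + κ * r - um + 4 * ww um r) = V r - (v + κ * r) by ring]; exact hVr)
  have hb : |MM um (V r) r - MM um (v + κ * r) r| ≤ um *
      |Real.sign (V r - um - 4 * ww um r) - Real.sign (v + κ * r - um - 4 * ww um r)| + um *
      |Real.sign (V r - um + 4 * ww um r) - Real.sign (v + κ * r - um + 4 * ww um r)| := by
    unfold MM
    refine le_trans (le_of_eq ?_) (le_trans (abs_add_le
      (um * (Real.sign (V r - um - 4 * ww um r) - Real.sign (v + κ * r - um - 4 * ww um r)))
      (um * (Real.sign (V r - um + 4 * ww um r) - Real.sign (v + κ * r - um + 4 * ww um r)))) ?_)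
    · congr 1; ring
    · rw [abs_mul, abs_mul, abs_of_pos hum]
  have hb2 : |MM um (V r) r - MM um (v + κ * r) r| ≤ 2 * um *
      ((if |v + κ * r - um - 4 * ww um r| ≤ ρ then 1 else 0) +
       (if |v + κ * r - um + 4 * ww um r| ≤ ρ then 1 else 0)) := by
    refine hb.trans ?_
    have := mul_le_mul_of_nonneg_left d1 hum.le
    have := mul_le_mul_of_nonneg_left d2 hum.le
    linarith
  refine hb2.trans ?_
  simp only [J]
  have n1 := ind_nonneg (v - um) (κ - 4*um) ρ r
  have n2 := ind_nonneg (v - um) (κ + 4*um) ρ r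
  have n3 := ind_nonneg (v + 3*um) (κ - 4*um) ρ r
  have n4 := ind_nonneg (v - 5*um) (κ + 4*um) ρ r
  refine mul_le_mul_of_nonneg_left ?_ (by linarith)
  rcases lt_or_ge r (1/2) with hh | hh
  · have e1 : (if |v + κ * r - um - 4 * ww um r| ≤ ρ then (1:ℝ) else 0) = ind (v - um) (κ - 4*um) ρ r := by
      unfold ind; rw [ww_left hr.1 hh]; congr 3; ring
    have e2 : (if |v + κ * r - um + 4 * ww um r| ≤ ρ then (1:ℝ) else 0) = ind (v - um) (κ + 4*um) ρ r := by
      unfold ind; rw [ww_left hr.1 hh]; congr 3; ring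
    rw [e1, e2]; linarith
  · have e1 : (if |v + κ * r - um - 4 * ww um r| ≤ ρ then (1:ℝ) else 0) = ind (v + 3*um) (κ - 4*um) ρ r := by
      unfold ind; rw [ww_right hh hr1]; congr 3; ring
    have e2 : (if |v + κ * r - um + 4 * ww um r| ≤ ρ then (1:ℝ) else 0) = ind (v - 5*um) (κ + 4*um) ρ r := by
      unfold ind; rw [ww_right hh hr1]; congr 3; ring
    rw [e1, e2]; linarith

end
end PWM
open MeasureTheory
namespace PWM
noncomputable section

/-- bounded, Lipschitz, with quadratic Taylor remainder -/
structure Nice {E F : Type*} [NormedAddCommGroup E] [NormedSpace ℝ E] [NormedAddCommGroup F]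
    [NormedSpace ℝ F] (C : ℝ) (φ : E → F) (D : E → E →L[ℝ] F) : Prop where
  cont : Continuous φ
  bdd : ∀ x, ‖φ x‖ ≤ C
  dbd : ∀ x, ‖D x‖ ≤ C
  lip : ∀ x y, ‖φ x - φ y‖ ≤ C * ‖x - y‖
  tay : ∀ x y, ‖φ y - φ x - D x (y - x)‖ ≤ C * ‖y - x‖ ^ 2

lemma ii_smul_const {E : Type*} [NormedAddCommGroup E] [NormedSpace ℝ E] {φ : ℝ → ℝ} {a b : ℝ}
    (h : IntervalIntegrable φ volume a b) (c : E) :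
    IntervalIntegrable (fun r => φ r • c) volume a b :=
  ⟨h.1.smul_const c, h.2.smul_const c⟩

lemma int_aff {φ : ℝ → ℝ} {s : ℝ} (h : IntervalIntegrable φ volume 0 s) (A c : ℝ) :
    ∫ r in (0:ℝ)..s, (A + φ r * c) = s * A + (∫ r in (0:ℝ)..s, φ r) * c := by
  rw [intervalIntegral.integral_add intervalIntegrable_const (h.mul_const _)]
  congr 1
  · simp
  · exact intervalIntegral.integral_mul_const _ _

variable {E F : Type*} [NormedAddCommGroup E] [NormedSpace ℝ E] [CompleteSpace E]
  [NormedAddCommGroup F] [NormedSpace ℝ F] [CompleteSpace F]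

/-- the data -/
structure Sys (E F : Type*) [NormedAddCommGroup E] [NormedSpace ℝ E]
    [NormedAddCommGroup F] [NormedSpace ℝ F] where
  um : ℝ
  δ : ℝ
  C : ℝ
  f : E → E
  g : E → E
  h : E → ℝ
  Df : E → E →L[ℝ] E
  Dg : E → E →L[ℝ] E
  Dh : E → E →L[ℝ] ℝ
  α : F × (ℝ × ℝ) × ℝ → ℝ
  Dα : F × (ℝ × ℝ) × ℝ → (F × (ℝ × ℝ) × ℝ) →L[ℝ] ℝ
  a : F × (ℝ × ℝ) × ℝ → F
  hum : 0 < um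
  hδ : 0 < δ
  hC : 1 ≤ C
  humC : um ≤ C
  nf : Nice C f Df
  ng : Nice C g Dg
  nh : Nice C h Dh
  nα : Nice C α Dα
  αr : ∀ p, |α p| ≤ um - δ
  ac : Continuous a
  ab : ∀ p, ‖a p‖ ≤ C
  al : ∀ p p', ‖a p - a p'‖ ≤ C * ‖p - p'‖
  qc : Continuous fun x => Dh x (g x)
  ql : ∀ x y, |Dh x (g x) - Dh y (g y)| ≤ C * ‖x - y‖

namespace Sys
variable (S : Sys E F)

/-- augmented output -/
def Hf (ε : ℝ) (x : E) : ℝ × ℝ := (S.h x, ε * S.Dh x (S.g x))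
/-- control evaluated at a triple -/
def A (ε : ℝ) (η : F) (x : E) (t : ℝ) : ℝ := S.α (η, S.Hf ε x, t)
/-- controller field -/
def B (ε : ℝ) (η : F) (x : E) (t : ℝ) : F := S.a (η, S.Hf ε x, t)
/-- corrected state -/
def Z (ε : ℝ) (η : F) (x : E) (t σ : ℝ) : E := x - (ε * SS S.um (S.A ε η x t) σ) • S.g x

lemma C0 : 0 < S.C := by linarith [S.hC]

lemma A_abs (ε : ℝ) (η : F) (x : E) (t : ℝ) : |S.A ε η x t| ≤ S.um :=
  (S.αr _).trans (by linarith [S.hδ])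

lemma SS_abs (ε : ℝ) (η : F) (x : E) (t σ : ℝ) : |SS S.um (S.A ε η x t) σ| ≤ 2 * S.C :=
  (abs_SS_le S.hum (S.A_abs _ _ _ _) _).trans (by linarith [S.humC])

lemma Hf_cont (ε : ℝ) : Continuous (S.Hf ε) := S.nh.cont.prodMk (continuous_const.mul S.qc)

lemma Hf_lip {ε : ℝ} (h0 : 0 ≤ ε) (h1 : ε ≤ 1) (x y : E) :
    ‖S.Hf ε x - S.Hf ε y‖ ≤ S.C * ‖x - y‖ := by
  rw [norm_prod_le_iff]
  refine ⟨S.nh.lip x y, ?_⟩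
  simp only [Hf, Prod.snd_sub]
  rw [← mul_sub, Real.norm_eq_abs, abs_mul, abs_of_nonneg h0]
  calc _ ≤ 1 * (S.C * ‖x - y‖) := by gcongr; exact S.ql x y
    _ = _ := one_mul _

lemma arg_lip {ε : ℝ} (h0 : 0 ≤ ε) (h1 : ε ≤ 1) (η η' : F) (x x' : E) (t t' : ℝ) :
    ‖(η, S.Hf ε x, t) - (η', S.Hf ε x', t')‖ ≤ ‖η - η'‖ + S.C * ‖x - x'‖ + |t - t'| := by
  have hc : 0 ≤ S.C * ‖x - x'‖ := mul_nonneg S.C0.le (norm_nonneg _)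
  have := S.Hf_lip h0 h1 x x'
  have h2 := norm_nonneg (η - η')
  have h3 := abs_nonneg (t - t')
  rw [norm_prod_le_iff]
  refine ⟨?_, ?_⟩
  · simp only [Prod.fst_sub]; linarith
  · rw [norm_prod_le_iff]
    refine ⟨?_, ?_⟩
    · simp only [Prod.fst_sub, Prod.snd_sub]; linarith
    · simp only [Prod.snd_sub, Real.norm_eq_abs]; linarith

lemma A_lip {ε : ℝ} (h0 : 0 ≤ ε) (h1 : ε ≤ 1) (η η' : F) (x x' : E) (t t' : ℝ) :
    |S.A ε η x t - S.A ε η' x' t'| ≤ S.C * (‖η - η'‖ + S.C * ‖x - x'‖ + |t - t'|) :=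
  (S.nα.lip _ _).trans (mul_le_mul_of_nonneg_left (S.arg_lip h0 h1 _ _ _ _ _ _) S.C0.le)

lemma B_lip {ε : ℝ} (h0 : 0 ≤ ε) (h1 : ε ≤ 1) (η η' : F) (x x' : E) (t t' : ℝ) :
    ‖S.B ε η x t - S.B ε η' x' t'‖ ≤ S.C * (‖η - η'‖ + S.C * ‖x - x'‖ + |t - t'|) :=
  (S.al _ _).trans (mul_le_mul_of_nonneg_left (S.arg_lip h0 h1 _ _ _ _ _ _) S.C0.le)

lemma A_meas (ε : ℝ) {η : ℝ → F} {x : ℝ → E} {t : ℝ → ℝ} (hη : StronglyMeasurable η)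
    (hx : StronglyMeasurable x) (ht : StronglyMeasurable t) :
    StronglyMeasurable fun r => S.A ε (η r) (x r) (t r) :=
  S.nα.cont.comp_stronglyMeasurable
    (hη.prodMk (((S.Hf_cont ε).comp_stronglyMeasurable hx).prodMk ht))

lemma B_meas (ε : ℝ) {η : ℝ → F} {x : ℝ → E} {t : ℝ → ℝ} (hη : StronglyMeasurable η)
    (hx : StronglyMeasurable x) (ht : StronglyMeasurable t) :
    StronglyMeasurable fun r => S.B ε (η r) (x r) (t r) :=
  S.ac.comp_stronglyMeasurable
    (hη.prodMk (((S.Hf_cont ε).comp_stronglyMeasurable hx).prodMk ht))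

lemma Z_meas (ε : ℝ) {η : ℝ → F} {x : ℝ → E} {t s : ℝ → ℝ} (hη : StronglyMeasurable η)
    (hx : StronglyMeasurable x) (ht : StronglyMeasurable t) (hs : Measurable s) :
    StronglyMeasurable fun r => S.Z ε (η r) (x r) (t r) (s r) := by
  unfold Z
  refine hx.sub (StronglyMeasurable.smul ?_ (S.ng.cont.comp_stronglyMeasurable hx))
  exact (measurable_const.mul (measurable_SS _ (S.A_meas ε hη hx ht).measurable hs)).stronglyMeasurable

lemma Z_sub_le {ε : ℝ} (h0 : 0 ≤ ε) (η : F) (x : E) (t σ : ℝ) :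
    ‖S.Z ε η x t σ - x‖ ≤ 2 * S.C ^ 2 * ε := by
  unfold Z
  rw [sub_sub_cancel_left, norm_neg, norm_smul, Real.norm_eq_abs, abs_mul, abs_of_nonneg h0]
  calc _ ≤ ε * (2 * S.C) * S.C := by
        gcongr
        · exact mul_nonneg h0 (by linarith [S.C0])
        · exact S.SS_abs _ _ _ _ _
        · exact S.ng.bdd _
    _ = _ := by ring

/-- averaged field -/
def Fd (ε : ℝ) (η : F) (x : E) (t : ℝ) : E := S.f x + S.A ε η x t • S.g x

lemma Fd_bdd (ε : ℝ) (η : F) (x : E) (t : ℝ) : ‖S.Fd ε η x t‖ ≤ 2 * S.C ^ 2 := by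
  unfold Fd
  refine (norm_add_le _ _).trans ?_
  rw [norm_smul, Real.norm_eq_abs]
  have h1 := S.nf.bdd x
  have h2 : |S.A ε η x t| * ‖S.g x‖ ≤ S.C * S.C :=
    mul_le_mul ((S.A_abs _ _ _ _).trans S.humC) (S.ng.bdd x) (norm_nonneg _) S.C0.le
  nlinarith [S.hC]

lemma Fd_lip {ε : ℝ} (h0 : 0 ≤ ε) (h1 : ε ≤ 1) (η η' : F) (x x' : E) (t t' : ℝ) :
    ‖S.Fd ε η x t - S.Fd ε η' x' t'‖ ≤ 3 * S.C ^ 3 * (‖η - η'‖ + ‖x - x'‖ + |t - t'|) := by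
  unfold Fd
  have e : S.f x + S.A ε η x t • S.g x - (S.f x' + S.A ε η' x' t' • S.g x') =
    (S.f x - S.f x') + (S.A ε η x t • (S.g x - S.g x') + (S.A ε η x t - S.A ε η' x' t') • S.g x') := by
    module
  rw [e]
  refine (norm_add_le _ _).trans ((add_le_add_right (norm_add_le _ _) _).trans ?_)
  rw [norm_smul, norm_smul, Real.norm_eq_abs, Real.norm_eq_abs]
  have a1 := S.nf.lip x x'
  have a2 : |S.A ε η x t| * ‖S.g x - S.g x'‖ ≤ S.C * (S.C * ‖x - x'‖) :=
    mul_le_mul ((S.A_abs _ _ _ _).trans S.humC) (S.ng.lip x x') (norm_nonneg _) S.C0.le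
  have hn1 := norm_nonneg (η - η')
  have hn2 := norm_nonneg (x - x')
  have hn3 := abs_nonneg (t - t')
  have hC := S.hC
  have a3 : |S.A ε η x t - S.A ε η' x' t'| * ‖S.g x'‖ ≤
      S.C * (‖η - η'‖ + S.C * ‖x - x'‖ + |t - t'|) * S.C :=
    mul_le_mul (S.A_lip h0 h1 _ _ _ _ _ _) (S.ng.bdd x') (norm_nonneg _) (by have := S.C0; positivity)
  have p1 : S.C ≤ S.C ^ 3 := le_self_pow₀ hC (by norm_num)
  have p2 : S.C ^ 2 ≤ S.C ^ 3 := pow_le_pow_right₀ hC (by norm_num)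
  have p0 := S.C0
  calc _ ≤ S.C * ‖x - x'‖ + (S.C * (S.C * ‖x - x'‖) + S.C * (‖η - η'‖ + S.C * ‖x - x'‖ + |t - t'|) * S.C) := by
        gcongr
    _ = S.C * ‖x - x'‖ + S.C^2 * ‖x - x'‖ + (S.C^2 * ‖η - η'‖ + S.C^3 * ‖x - x'‖ + S.C^2 * |t - t'|) := by ring
    _ ≤ S.C^3 * ‖x - x'‖ + S.C^3 * ‖x - x'‖ + (S.C^3 * ‖η - η'‖ + S.C^3 * ‖x - x'‖ + S.C^3 * |t - t'|) := by
        gcongr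
    _ ≤ _ := by nlinarith [pow_pos p0 3, mul_nonneg (pow_pos p0 3).le hn1, mul_nonneg (pow_pos p0 3).le hn3]

lemma Fd_meas (ε : ℝ) {η : ℝ → F} {x : ℝ → E} {t : ℝ → ℝ} (hη : StronglyMeasurable η)
    (hx : StronglyMeasurable x) (ht : StronglyMeasurable t) :
    StronglyMeasurable fun r => S.Fd ε (η r) (x r) (t r) :=
  (S.nf.cont.comp_stronglyMeasurable hx).add
    ((S.A_meas ε hη hx ht).smul (S.ng.cont.comp_stronglyMeasurable hx))

/-- solution on one (possibly truncated) period, in rescaled time -/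
structure Per (ε T b : ℝ) (X : ℝ → E) (N : ℝ → F) (Zr : ℝ → E) (V : ℝ → ℝ) : Prop where
  e0 : 0 < ε
  e1 : ε ≤ 1
  b0 : 0 ≤ b
  b1 : b ≤ 1
  Xc : Continuous X
  Nc : Continuous N
  hZ : ∀ r, Zr r = S.Z ε (N r) (X r) (T + ε * r) r
  hV : ∀ r, V r = S.A ε (N r) (Zr r) (T + ε * r)
  eX : ∀ σ ∈ Set.Icc 0 b, X σ = X 0 + ε • ∫ r in (0:ℝ)..σ, (S.f (X r) + MM S.um (V r) r • S.g (X r))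
  eN : ∀ σ ∈ Set.Icc 0 b, N σ = N 0 + ε • ∫ r in (0:ℝ)..σ, S.B ε (N r) (Zr r) (T + ε * r)

variable {S}
namespace Per
variable {ε T b : ℝ} {X : ℝ → E} {N : ℝ → F} {Zr : ℝ → E} {V : ℝ → ℝ}

lemma tm : StronglyMeasurable fun r : ℝ => T + ε * r :=
  (by fun_prop : Continuous fun r : ℝ => T + ε * r).stronglyMeasurable

lemma Zm (P : S.Per ε T b X N Zr V) : StronglyMeasurable Zr := by
  rw [show Zr = _ from funext P.hZ]
  exact S.Z_meas ε P.Nc.stronglyMeasurable P.Xc.stronglyMeasurable tm measurable_id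

lemma Vm (P : S.Per ε T b X N Zr V) : StronglyMeasurable V := by
  rw [show V = _ from funext P.hV]
  exact S.A_meas ε P.Nc.stronglyMeasurable P.Zm tm

lemma Z0 (P : S.Per ε T b X N Zr V) : Zr 0 = X 0 := by
  rw [P.hZ, Z, SS_zero]; simp

lemma Vabs (P : S.Per ε T b X N Zr V) (r : ℝ) : |V r| ≤ S.um := by
  rw [P.hV]; exact S.A_abs _ _ _ _

lemma V0 (P : S.Per ε T b X N Zr V) : V 0 = S.A ε (N 0) (X 0) T := by
  rw [P.hV, P.Z0]; simp

lemma bX (P : S.Per ε T b X N Zr V) {σ : ℝ} (hσ : σ ∈ Set.Icc 0 b) :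
    ‖X σ - X 0‖ ≤ 4 * S.C ^ 2 * ε := by
  rw [P.eX σ hσ, add_sub_cancel_left, norm_smul, Real.norm_eq_abs, abs_of_pos P.e0, mul_comm]
  refine mul_le_mul_of_nonneg_right ?_ P.e0.le
  have hσ1 : |σ - 0| ≤ 1 := by rw [sub_zero, abs_of_nonneg hσ.1]; exact hσ.2.trans P.b1
  have := intervalIntegral.norm_integral_le_of_norm_le_const (a := 0) (b := σ) (C := 4 * S.C^2)
    (f := fun r => S.f (X r) + MM S.um (V r) r • S.g (X r)) (fun r _ => by
      refine (norm_add_le _ _).trans ?_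
      rw [norm_smul, Real.norm_eq_abs]
      have h1 := S.nf.bdd (X r)
      have h2 : |MM S.um (V r) r| * ‖S.g (X r)‖ ≤ (3 * S.C) * S.C :=
        mul_le_mul ((abs_MM_le S.hum _ _).trans (by linarith [S.humC])) (S.ng.bdd _) (norm_nonneg _)
          (by linarith [S.C0])
      nlinarith [S.hC])
  refine this.trans (mul_le_of_le_one_right (by positivity) hσ1)

lemma bN (P : S.Per ε T b X N Zr V) {σ : ℝ} (hσ : σ ∈ Set.Icc 0 b) :
    ‖N σ - N 0‖ ≤ S.C * ε := by
  rw [P.eN σ hσ, add_sub_cancel_left, norm_smul, Real.norm_eq_abs, abs_of_pos P.e0, mul_comm]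
  refine mul_le_mul_of_nonneg_right ?_ P.e0.le
  have hσ1 : |σ - 0| ≤ 1 := by rw [sub_zero, abs_of_nonneg hσ.1]; exact hσ.2.trans P.b1
  have := intervalIntegral.norm_integral_le_of_norm_le_const (a := 0) (b := σ) (C := S.C)
    (f := fun r => S.B ε (N r) (Zr r) (T + ε * r)) (fun r _ => S.ab _)
  exact this.trans (mul_le_of_le_one_right S.C0.le hσ1)

lemma bZ (P : S.Per ε T b X N Zr V) {σ : ℝ} (hσ : σ ∈ Set.Icc 0 b) :
    ‖Zr σ - X 0‖ ≤ 6 * S.C ^ 2 * ε := by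
  rw [show Zr σ - X 0 = (Zr σ - X σ) + (X σ - X 0) by abel]
  refine (norm_add_le _ _).trans ?_
  have h1 := S.Z_sub_le P.e0.le (N σ) (X σ) (T + ε * σ) σ
  rw [← P.hZ] at h1
  linarith [P.bX hσ]

lemma bt (P : S.Per ε T b X N Zr V) {σ : ℝ} (hσ : σ ∈ Set.Icc 0 b) :
    |T + ε * σ - T| ≤ ε := by
  rw [add_sub_cancel_left, abs_of_nonneg (mul_nonneg P.e0.le hσ.1)]
  exact mul_le_of_le_one_right P.e0.le (hσ.2.trans P.b1)

lemma bV (P : S.Per ε T b X N Zr V) {σ : ℝ} (hσ : σ ∈ Set.Icc 0 b) :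
    |V σ - V 0| ≤ 8 * S.C ^ 4 * ε := by
  rw [P.V0, P.hV σ]
  refine (S.A_lip P.e0.le P.e1 _ _ _ _ _ _).trans ?_
  have h0 := P.e0
  have hC := S.C0
  calc _ ≤ S.C * (S.C * ε + S.C * (6 * S.C ^ 2 * ε) + ε) := by
        gcongr
        · exact P.bN hσ
        · exact P.bZ hσ
        · exact P.bt hσ
    _ = (S.C^2 + 6 * S.C^4 + S.C) * ε := by ring
    _ ≤ (S.C^4 + 6 * S.C^4 + S.C^4) * ε := by
        have p1 : S.C ≤ S.C ^ 4 := le_self_pow₀ S.hC (by norm_num)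
        have p2 : S.C ^ 2 ≤ S.C ^ 4 := pow_le_pow_right₀ S.hC (by norm_num)
        gcongr
    _ = _ := by ring

lemma bU (P : S.Per ε T b X N Zr V) {σ : ℝ} (hσ : σ ∈ Set.Icc 0 b) :
    |S.A ε (N σ) (X σ) (T + ε * σ) - V 0| ≤ 8 * S.C ^ 4 * ε := by
  rw [P.V0]
  refine (S.A_lip P.e0.le P.e1 _ _ _ _ _ _).trans ?_
  have h0 := P.e0
  have hC := S.C0
  calc _ ≤ S.C * (S.C * ε + S.C * (4 * S.C ^ 2 * ε) + ε) := by
        gcongr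
        · exact P.bN hσ
        · exact P.bX hσ
        · exact P.bt hσ
    _ = (S.C^2 + 4 * S.C^4 + S.C) * ε := by ring
    _ ≤ (S.C^4 + 6 * S.C^4 + S.C^4) * ε := by
        have p1 : S.C ≤ S.C ^ 4 := le_self_pow₀ S.hC (by norm_num)
        have p2 : S.C ^ 2 ≤ S.C ^ 4 := pow_le_pow_right₀ S.hC (by norm_num)
        gcongr
        norm_num
    _ = _ := by ring

lemma MVm (P : S.Per ε T b X N Zr V) : StronglyMeasurable fun r => MM S.um (V r) r :=
  (measurable_MM _ P.Vm.measurable measurable_id).stronglyMeasurable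

lemma ii_rhs (P : S.Per ε T b X N Zr V) {σ : ℝ} (hσ : 0 ≤ σ) :
    IntervalIntegrable (fun r => S.f (X r) + MM S.um (V r) r • S.g (X r)) volume 0 σ := by
  refine ii_of_bdd (((S.nf.cont.comp P.Xc).stronglyMeasurable).add
    (P.MVm.smul (S.ng.cont.comp P.Xc).stronglyMeasurable)) (B := S.C + 3 * S.um * S.C) hσ fun r _ => ?_
  refine (norm_add_le _ _).trans (add_le_add (S.nf.bdd _) ?_)
  show ‖MM S.um (V r) r • S.g (X r)‖ ≤ _
  rw [norm_smul]
  exact mul_le_mul (abs_MM_le S.hum _ _) (S.ng.bdd _) (norm_nonneg _) (by linarith [S.hum])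

lemma int_diff (P : S.Per ε T b X N Zr V) {σ : ℝ} (hσ : σ ∈ Set.Icc 0 b) :
    ∫ r in (0:ℝ)..σ, |MM S.um (V r) r - MM S.um (V 0) r| ≤ 48 * S.C ^ 4 * ε := by
  have := int_MM_diff (v := V 0) (κ := 0) (ρ := 8 * S.C^4 * ε) S.hum (by simpa using S.hum.le)
    (by have := P.e0; have := S.C0; positivity) hσ.1 (hσ.2.trans P.b1) P.Vm.measurable
    (fun r hr => by simpa using P.bV ⟨hr.1, hr.2.trans hσ.2⟩)
  simp only [zero_mul, add_zero] at this
  linarith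

lemma expX (P : S.Per ε T b X N Zr V) {σ : ℝ} (hσ : σ ∈ Set.Icc 0 b) :
    ‖X σ - X 0 - ε • (σ • (S.f (X 0) + V 0 • S.g (X 0)) + SS S.um (V 0) σ • S.g (X 0))‖
      ≤ 64 * S.C ^ 5 * ε ^ 2 := by
  have i1 := P.ii_rhs hσ.1
  have iM := ii_MM S.hum (measurable_const (a := V 0)) hσ.1
  have i2 : IntervalIntegrable (fun r => S.f (X 0) + MM S.um (V 0) r • S.g (X 0)) volume 0 σ :=
    IntervalIntegrable.add intervalIntegrable_const (ii_smul_const iM _)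
  have hσ1 := hσ.2.trans P.b1
  have e2 : ∫ r in (0:ℝ)..σ, (S.f (X 0) + MM S.um (V 0) r • S.g (X 0)) =
      σ • (S.f (X 0) + V 0 • S.g (X 0)) + SS S.um (V 0) σ • S.g (X 0) := by
    rw [intervalIntegral.integral_add intervalIntegrable_const (ii_smul_const iM _),
      intervalIntegral.integral_smul_const, int_MM S.hum (P.Vabs 0) hσ.1 hσ1]
    simp only [intervalIntegral.integral_const, sub_zero]
    module
  rw [← e2, P.eX σ hσ, add_sub_cancel_left, ← smul_sub, ← intervalIntegral.integral_sub i1 i2,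
    norm_smul, Real.norm_eq_abs, abs_of_pos P.e0]
  have id : IntervalIntegrable (fun r => |MM S.um (V r) r - MM S.um (V 0) r|) volume 0 σ :=
    ((ii_MM S.hum P.Vm.measurable hσ.1).sub iM).abs
  have ig : IntervalIntegrable (fun r => 16 * S.C^4 * ε + |MM S.um (V r) r - MM S.um (V 0) r| * S.C) volume 0 σ :=
    IntervalIntegrable.add intervalIntegrable_const (id.mul_const _)
  have h0 := P.e0
  have hC := S.C0
  have key := intervalIntegral.norm_integral_le_of_norm_le hσ.1 (μ := volume)
    (f := fun r => S.f (X r) + MM S.um (V r) r • S.g (X r) - (S.f (X 0) + MM S.um (V 0) r • S.g (X 0)))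
    (ae_of_all _ fun r hr => by
      have hr' : r ∈ Set.Icc 0 b := ⟨hr.1.le, hr.2.trans hσ.2⟩
      have e : S.f (X r) + MM S.um (V r) r • S.g (X r) - (S.f (X 0) + MM S.um (V 0) r • S.g (X 0)) =
        (S.f (X r) - S.f (X 0)) + (MM S.um (V r) r • (S.g (X r) - S.g (X 0)) +
          (MM S.um (V r) r - MM S.um (V 0) r) • S.g (X 0)) := by module
      show ‖_‖ ≤ 16 * S.C^4 * ε + |MM S.um (V r) r - MM S.um (V 0) r| * S.C
      rw [e]
      refine (norm_add_le _ _).trans ((add_le_add_right (norm_add_le _ _) _).trans ?_)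
      rw [norm_smul, norm_smul, Real.norm_eq_abs, Real.norm_eq_abs]
      have a1 : ‖S.f (X r) - S.f (X 0)‖ ≤ S.C * (4 * S.C^2 * ε) :=
        (S.nf.lip _ _).trans (mul_le_mul_of_nonneg_left (P.bX hr') hC.le)
      have a2 : ‖S.g (X r) - S.g (X 0)‖ ≤ S.C * (4 * S.C^2 * ε) :=
        (S.ng.lip _ _).trans (mul_le_mul_of_nonneg_left (P.bX hr') hC.le)
      have a3 : |MM S.um (V r) r| ≤ 3 * S.C := (abs_MM_le S.hum _ _).trans (by linarith [S.humC])
      have a4 := S.ng.bdd (X 0)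
      have p1 : S.C ^ 3 ≤ S.C ^ 4 := pow_le_pow_right₀ S.hC (by norm_num)
      calc _ ≤ S.C * (4 * S.C^2 * ε) + (3 * S.C * (S.C * (4 * S.C^2 * ε)) +
            |MM S.um (V r) r - MM S.um (V 0) r| * S.C) := by gcongr
        _ = 4 * S.C^3 * ε + 12 * S.C^4 * ε + |MM S.um (V r) r - MM S.um (V 0) r| * S.C := by ring
        _ ≤ 4 * S.C^4 * ε + 12 * S.C^4 * ε + |MM S.um (V r) r - MM S.um (V 0) r| * S.C := by gcongr
        _ = _ := by ring) ig
  rw [int_aff id] at key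
  have b1 := P.int_diff hσ
  have p1 : S.C ^ 4 ≤ S.C ^ 5 := pow_le_pow_right₀ S.hC (by norm_num)
  calc _ ≤ ε * (σ * (16 * S.C^4 * ε) + (∫ r in (0:ℝ)..σ, |MM S.um (V r) r - MM S.um (V 0) r|) * S.C) :=
        mul_le_mul_of_nonneg_left key h0.le
    _ ≤ ε * (1 * (16 * S.C^5 * ε) + (48 * S.C ^ 4 * ε) * S.C) := by gcongr
    _ = _ := by ring

end Per
end Sys
end
end PWM
open MeasureTheory
namespace PWM
noncomputable section
variable {E F : Type*} [NormedAddCommGroup E] [NormedSpace ℝ E] [CompleteSpace E]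
  [NormedAddCommGroup F] [NormedSpace ℝ F] [CompleteSpace F]
namespace Sys
variable {S : Sys E F}
namespace Per
variable {ε T b : ℝ} {X : ℝ → E} {N : ℝ → F} {Zr : ℝ → E} {V : ℝ → ℝ}

lemma expXZ (P : S.Per ε T b X N Zr V) {σ : ℝ} (hσ : σ ∈ Set.Icc 0 b) :
    ‖X σ - Zr σ - (ε * SS S.um (V 0) σ) • S.g (X 0)‖ ≤ 16 * S.C ^ 5 * ε ^ 2 := by
  have h0 := P.e0
  have hC := S.C0
  rw [P.hZ, Z]
  set U := S.A ε (N σ) (X σ) (T + ε * σ) with hU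
  have e : X σ - (X σ - (ε * SS S.um U σ) • S.g (X σ)) - (ε * SS S.um (V 0) σ) • S.g (X 0)
    = ε • ((SS S.um U σ - SS S.um (V 0) σ) • S.g (X 0) + SS S.um U σ • (S.g (X σ) - S.g (X 0))) := by
    module
  rw [e, norm_smul, Real.norm_eq_abs, abs_of_pos h0]
  have a1 : |SS S.um U σ - SS S.um (V 0) σ| ≤ 8 * S.C ^ 4 * ε := (SS_lip S.hum _ _ _).trans (P.bU hσ)
  have a2 : ‖S.g (X σ) - S.g (X 0)‖ ≤ S.C * (4 * S.C^2 * ε) :=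
    (S.ng.lip _ _).trans (mul_le_mul_of_nonneg_left (P.bX hσ) hC.le)
  have a3 : |SS S.um U σ| ≤ 2 * S.C := S.SS_abs _ _ _ _ _
  have a4 := S.ng.bdd (X 0)
  have p1 : S.C ^ 4 ≤ S.C ^ 5 := pow_le_pow_right₀ S.hC (by norm_num)
  have : ‖(SS S.um U σ - SS S.um (V 0) σ) • S.g (X 0) + SS S.um U σ • (S.g (X σ) - S.g (X 0))‖
      ≤ 16 * S.C^5 * ε := by
    refine (norm_add_le _ _).trans ?_
    rw [norm_smul, norm_smul, Real.norm_eq_abs, Real.norm_eq_abs]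
    calc _ ≤ 8 * S.C ^ 4 * ε * S.C + 2 * S.C * (S.C * (4 * S.C^2 * ε)) := by gcongr
      _ = 8 * S.C ^ 5 * ε + 8 * S.C ^ 4 * ε := by ring
      _ ≤ 8 * S.C ^ 5 * ε + 8 * S.C ^ 5 * ε := by gcongr
      _ = _ := by ring
  calc _ ≤ ε * (16 * S.C^5 * ε) := mul_le_mul_of_nonneg_left this h0.le
    _ = _ := by ring

lemma expZ (P : S.Per ε T b X N Zr V) {σ : ℝ} (hσ : σ ∈ Set.Icc 0 b) :
    ‖Zr σ - X 0 - (ε * σ) • (S.f (X 0) + V 0 • S.g (X 0))‖ ≤ 80 * S.C ^ 5 * ε ^ 2 := by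
  have e : Zr σ - X 0 - (ε * σ) • (S.f (X 0) + V 0 • S.g (X 0)) =
    (X σ - X 0 - ε • (σ • (S.f (X 0) + V 0 • S.g (X 0)) + SS S.um (V 0) σ • S.g (X 0))) -
    (X σ - Zr σ - (ε * SS S.um (V 0) σ) • S.g (X 0)) := by module
  rw [e]
  refine (norm_sub_le _ _).trans ?_
  linarith [P.expX hσ, P.expXZ hσ]

lemma bArg (P : S.Per ε T b X N Zr V) {σ : ℝ} (hσ : σ ∈ Set.Icc 0 b) :
    ‖N σ - N 0‖ + S.C * ‖Zr σ - X 0‖ + |T + ε * σ - T| ≤ 8 * S.C ^ 3 * ε := by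
  have h0 := P.e0
  have hC := S.C0
  have p1 : S.C ≤ S.C ^ 3 := le_self_pow₀ S.hC (by norm_num)
  have p2 : 1 ≤ S.C ^ 3 := one_le_pow₀ S.hC
  calc _ ≤ S.C * ε + S.C * (6 * S.C ^ 2 * ε) + 1 * ε := by
        rw [one_mul]
        gcongr
        · exact P.bN hσ
        · exact P.bZ hσ
        · exact P.bt hσ
    _ ≤ S.C ^ 3 * ε + S.C * (6 * S.C ^ 2 * ε) + S.C ^ 3 * ε := by gcongr
    _ = _ := by ring

lemma ii_B (P : S.Per ε T b X N Zr V) {σ : ℝ} (hσ : 0 ≤ σ) :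
    IntervalIntegrable (fun r => S.B ε (N r) (Zr r) (T + ε * r)) volume 0 σ :=
  ii_of_bdd (S.B_meas ε P.Nc.stronglyMeasurable P.Zm tm) hσ fun _ _ => S.ab _

lemma ii_Fd (P : S.Per ε T b X N Zr V) {σ : ℝ} (hσ : 0 ≤ σ) :
    IntervalIntegrable (fun r => S.Fd ε (N r) (Zr r) (T + ε * r)) volume 0 σ :=
  ii_of_bdd (S.Fd_meas ε P.Nc.stronglyMeasurable P.Zm tm) hσ fun _ _ => S.Fd_bdd _ _ _ _

lemma expN (P : S.Per ε T b X N Zr V) {σ : ℝ} (hσ : σ ∈ Set.Icc 0 b) :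
    ‖N σ - N 0 - (ε * σ) • S.B ε (N 0) (X 0) T‖ ≤ 8 * S.C ^ 4 * ε ^ 2 := by
  have h0 := P.e0
  have hC := S.C0
  have hσ1 : |σ - 0| ≤ 1 := by rw [sub_zero, abs_of_nonneg hσ.1]; exact hσ.2.trans P.b1
  have e : N σ - N 0 - (ε * σ) • S.B ε (N 0) (X 0) T =
      ε • ∫ r in (0:ℝ)..σ, (S.B ε (N r) (Zr r) (T + ε * r) - S.B ε (N 0) (X 0) T) := by
    rw [intervalIntegral.integral_sub (P.ii_B hσ.1) intervalIntegrable_const, P.eN σ hσ,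
      intervalIntegral.integral_const]
    module
  rw [e, norm_smul, Real.norm_eq_abs, abs_of_pos h0]
  have := intervalIntegral.norm_integral_le_of_norm_le_const (a := 0) (b := σ) (C := 8 * S.C^4 * ε)
    (f := fun r => S.B ε (N r) (Zr r) (T + ε * r) - S.B ε (N 0) (X 0) T) (fun r hr => by
      rw [Set.uIoc_of_le hσ.1] at hr
      refine (S.B_lip h0.le P.e1 _ _ _ _ _ _).trans ?_
      calc _ ≤ S.C * (8 * S.C ^ 3 * ε) :=
            mul_le_mul_of_nonneg_left (P.bArg ⟨hr.1.le, hr.2.trans hσ.2⟩) hC.le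
        _ = _ := by ring)
  calc _ ≤ ε * (8 * S.C ^ 4 * ε) := by
        gcongr
        exact this.trans (mul_le_of_le_one_right (by positivity) hσ1)
    _ = _ := by ring

lemma w0_bdd (P : S.Per ε T b X N Zr V) : ‖S.f (X 0) + V 0 • S.g (X 0)‖ ≤ 2 * S.C ^ 2 := by
  have := S.Fd_bdd ε (N 0) (X 0) T
  rwa [Fd, ← P.V0] at this

lemma expV (P : S.Per ε T b X N Zr V) :
    ∃ p : ℝ, |p| ≤ 2 * S.C ^ 4 ∧ ∀ σ ∈ Set.Icc 0 b,
      |V σ - (V 0 + (ε * p) * σ)| ≤ 180 * S.C ^ 7 * ε ^ 2 := by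
  have h0 := P.e0
  have hC := S.C0
  set w0 := S.f (X 0) + V 0 • S.g (X 0) with hw0
  set dir : F × (ℝ × ℝ) × ℝ := (S.B ε (N 0) (X 0) T, (S.Dh (X 0) w0, 0), 1) with hdir
  set P0 : F × (ℝ × ℝ) × ℝ := (N 0, S.Hf ε (X 0), T) with hP0
  have hw : ‖w0‖ ≤ 2 * S.C ^ 2 := P.w0_bdd
  have p1 : S.C ≤ S.C ^ 3 := le_self_pow₀ S.hC (by norm_num)
  have p2 : 1 ≤ S.C ^ 3 := one_le_pow₀ S.hC
  have hd : ‖dir‖ ≤ 2 * S.C ^ 3 := by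
    rw [norm_prod_le_iff]
    refine ⟨?_, ?_⟩
    · show ‖S.B ε (N 0) (X 0) T‖ ≤ _
      exact (S.ab _).trans (by linarith)
    · rw [norm_prod_le_iff]
      refine ⟨?_, ?_⟩
      · rw [norm_prod_le_iff]
        refine ⟨?_, ?_⟩
        · show ‖S.Dh (X 0) w0‖ ≤ _
          calc _ ≤ S.C * (2 * S.C ^ 2) := (S.Dh (X 0)).le_of_opNorm_le_of_le (S.nh.dbd _) hw
            _ = _ := by ring
        · show ‖(0:ℝ)‖ ≤ _
          rw [norm_zero]; positivity
      · show ‖(1:ℝ)‖ ≤ _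
        rw [norm_one]; linarith
  refine ⟨S.Dα P0 dir, ?_, fun σ hσ => ?_⟩
  · calc _ ≤ S.C * (2 * S.C ^ 3) := (S.Dα P0).le_of_opNorm_le_of_le (S.nα.dbd _) hd
      _ = _ := by ring
  · set Pσ : F × (ℝ × ℝ) × ℝ := (N σ, S.Hf ε (Zr σ), T + ε * σ) with hPσ
    have hV0 : V 0 = S.α P0 := P.V0
    have hVσ : V σ = S.α Pσ := P.hV σ
    have e : V σ - (V 0 + (ε * S.Dα P0 dir) * σ) = (S.α Pσ - S.α P0 - S.Dα P0 (Pσ - P0)) +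
        S.Dα P0 (Pσ - P0 - (ε * σ) • dir) := by
      rw [hV0, hVσ, map_sub (S.Dα P0) (Pσ - P0), map_smul, smul_eq_mul]; ring
    have t1 := S.nα.tay P0 Pσ
    have hn : ‖Pσ - P0‖ ≤ 8 * S.C ^ 3 * ε :=
      (S.arg_lip h0.le P.e1 _ _ _ _ _ _).trans (P.bArg hσ)
    have q1 : S.C ^ 4 ≤ S.C ^ 6 := pow_le_pow_right₀ S.hC (by norm_num)
    have q2 : S.C ^ 5 ≤ S.C ^ 6 := pow_le_pow_right₀ S.hC (by norm_num)
    have q3 : S.C ^ 3 ≤ S.C ^ 6 := pow_le_pow_right₀ S.hC (by norm_num)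
    have hε2 : 0 ≤ ε ^ 2 := by positivity
    have hC6 : 0 ≤ S.C ^ 6 * ε ^ 2 := by positivity
    have he : ‖Pσ - P0 - (ε * σ) • dir‖ ≤ 116 * S.C ^ 6 * ε ^ 2 := by
      rw [norm_prod_le_iff]
      refine ⟨?_, ?_⟩
      · show ‖N σ - N 0 - (ε * σ) • S.B ε (N 0) (X 0) T‖ ≤ _
        refine (P.expN hσ).trans ?_
        nlinarith [mul_le_mul_of_nonneg_right q1 hε2]
      · rw [norm_prod_le_iff]
        refine ⟨?_, ?_⟩
        · rw [norm_prod_le_iff]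
          refine ⟨?_, ?_⟩
          · show ‖S.h (Zr σ) - S.h (X 0) - (ε * σ) • S.Dh (X 0) w0‖ ≤ _
            have e : S.h (Zr σ) - S.h (X 0) - (ε * σ) • S.Dh (X 0) w0 =
              (S.h (Zr σ) - S.h (X 0) - S.Dh (X 0) (Zr σ - X 0)) +
                S.Dh (X 0) (Zr σ - X 0 - (ε * σ) • w0) := by
              rw [map_sub (S.Dh (X 0)) (Zr σ - X 0), map_smul]; ring
            rw [e]
            have b1 := S.nh.tay (X 0) (Zr σ)
            have b2 := (S.Dh (X 0)).le_of_opNorm_le_of_le (S.nh.dbd _) (P.expZ hσ)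
            have b3 := P.bZ hσ
            calc _ ≤ S.C * ‖Zr σ - X 0‖^2 + S.C * (80 * S.C ^ 5 * ε ^ 2) :=
                  (norm_add_le _ _).trans (add_le_add b1 b2)
              _ ≤ S.C * (6 * S.C ^ 2 * ε)^2 + S.C * (80 * S.C ^ 5 * ε ^ 2) := by gcongr
              _ = 36 * (S.C ^ 5 * ε^2) + 80 * S.C ^ 6 * ε^2 := by ring
              _ ≤ _ := by nlinarith [mul_le_mul_of_nonneg_right q2 hε2]
          · show ‖ε * S.Dh (Zr σ) (S.g (Zr σ)) - ε * S.Dh (X 0) (S.g (X 0)) - (ε * σ) • (0:ℝ)‖ ≤ _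
            rw [smul_zero, sub_zero, ← mul_sub, Real.norm_eq_abs, abs_mul, abs_of_pos h0]
            have b1 := S.ql (Zr σ) (X 0)
            have b3 := P.bZ hσ
            calc _ ≤ ε * (S.C * (6 * S.C ^ 2 * ε)) := by
                  gcongr
                  exact b1.trans (by gcongr)
              _ = 6 * (S.C ^ 3 * ε^2) := by ring
              _ ≤ _ := by nlinarith [mul_le_mul_of_nonneg_right q3 hε2]
        · show ‖T + ε * σ - T - (ε * σ) • (1:ℝ)‖ ≤ _
          rw [smul_eq_mul, show T + ε * σ - T - ε * σ * 1 = 0 by ring, norm_zero]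
          positivity
    have t2 := (S.Dα P0).le_of_opNorm_le_of_le (S.nα.dbd _) he
    rw [e]
    calc _ ≤ S.C * ‖Pσ - P0‖^2 + S.C * (116 * S.C ^ 6 * ε ^ 2) :=
          (norm_add_le _ _).trans (add_le_add t1 t2)
      _ ≤ S.C * (8 * S.C ^ 3 * ε)^2 + S.C * (116 * S.C ^ 6 * ε ^ 2) := by gcongr
      _ = _ := by ring

lemma partialBd (P : S.Per ε T b X N Zr V) {σ : ℝ} (hσ : σ ∈ Set.Icc 0 b) :
    ‖Zr σ - X 0 - ε • ∫ r in (0:ℝ)..σ, S.Fd ε (N r) (Zr r) (T + ε * r)‖ ≤ 104 * S.C ^ 6 * ε ^ 2 := by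
  have h0 := P.e0
  have hC := S.C0
  have hσ1 : |σ - 0| ≤ 1 := by rw [sub_zero, abs_of_nonneg hσ.1]; exact hσ.2.trans P.b1
  set w0 := S.f (X 0) + V 0 • S.g (X 0) with hw0
  have hw : w0 = S.Fd ε (N 0) (X 0) T := by rw [hw0, Fd, P.V0]
  have e : Zr σ - X 0 - ε • ∫ r in (0:ℝ)..σ, S.Fd ε (N r) (Zr r) (T + ε * r) =
     (Zr σ - X 0 - (ε * σ) • w0) - ε • ∫ r in (0:ℝ)..σ, (S.Fd ε (N r) (Zr r) (T + ε * r) - w0) := by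
    rw [intervalIntegral.integral_sub (P.ii_Fd hσ.1) intervalIntegrable_const,
      intervalIntegral.integral_const]
    module
  have := intervalIntegral.norm_integral_le_of_norm_le_const (a := 0) (b := σ) (C := 24 * S.C^6 * ε)
    (f := fun r => S.Fd ε (N r) (Zr r) (T + ε * r) - w0) (fun r hr => by
      rw [Set.uIoc_of_le hσ.1] at hr
      rw [hw]
      refine (S.Fd_lip h0.le P.e1 _ _ _ _ _ _).trans ?_
      have h1 := P.bArg (σ := r) ⟨hr.1.le, hr.2.trans hσ.2⟩
      have h2 : ‖Zr r - X 0‖ ≤ S.C * ‖Zr r - X 0‖ := le_mul_of_one_le_left (norm_nonneg _) S.hC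
      calc _ ≤ 3 * S.C^3 * (8 * S.C ^ 3 * ε) := by gcongr; linarith
        _ = _ := by ring)
  have p1 : S.C ^ 5 ≤ S.C ^ 6 := pow_le_pow_right₀ S.hC (by norm_num)
  rw [e]
  refine (norm_sub_le _ _).trans ?_
  rw [norm_smul, Real.norm_eq_abs, abs_of_pos h0]
  calc _ ≤ 80 * S.C ^ 5 * ε ^ 2 + ε * (24 * S.C ^ 6 * ε) := by
        gcongr
        · exact P.expZ hσ
        · exact this.trans (mul_le_of_le_one_right (by positivity) hσ1)
    _ ≤ 80 * S.C ^ 6 * ε ^ 2 + ε * (24 * S.C ^ 6 * ε) := by gcongr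
    _ = _ := by ring

lemma s0_mean (P : S.Per ε T 1 X N Zr V) (hε : ε * (2 * S.C ^ 4) ≤ S.δ) :
    |∫ r in (0:ℝ)..1, (MM S.um (V r) r - V r)| ≤ (1260 * S.C ^ 7 + 16 * S.C ^ 8 / S.um) * ε ^ 2 := by
  have h0 := P.e0
  have hC := S.C0
  have hu := S.hum
  obtain ⟨p, hp, hV⟩ := P.expV
  set κ := ε * p with hκ
  have hκ1 : |κ| ≤ ε * (2 * S.C ^ 4) := by
    rw [hκ, abs_mul, abs_of_pos h0]; gcongr
  have hκδ := hκ1.trans hε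
  have hδu : S.δ ≤ S.um := by
    have := (abs_nonneg _).trans (S.αr (N 0, S.Hf ε (X 0), T)); linarith
  have hv0 : |V 0| ≤ S.um - S.δ := by rw [P.V0]; exact S.αr _
  have iV : IntervalIntegrable V volume 0 1 :=
    ii_of_bdd P.Vm zero_le_one fun r _ => P.Vabs r
  have iM := ii_MM S.hum P.Vm.measurable (zero_le_one (α := ℝ))
  have iA := ii_MM S.hum (V := fun r => V 0 + κ * r) (by fun_prop) (zero_le_one (α := ℝ))
  have il : IntervalIntegrable (fun r => V 0 + κ * r) volume 0 1 :=
    (by fun_prop : Continuous fun r : ℝ => V 0 + κ * r).intervalIntegrable 0 1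
  have il2 : ∫ r in (0:ℝ)..1, (V 0 + κ * r) = V 0 + κ / 2 := by
    rw [intervalIntegral.integral_add intervalIntegrable_const
      ((by fun_prop : Continuous fun r : ℝ => κ * r).intervalIntegrable 0 1),
      intervalIntegral.integral_const_mul]
    simp; ring
  have e : ∫ r in (0:ℝ)..1, (MM S.um (V r) r - V r) =
      (∫ r in (0:ℝ)..1, (MM S.um (V r) r - MM S.um (V 0 + κ * r) r)) +
      ((∫ r in (0:ℝ)..1, MM S.um (V 0 + κ * r) r) - (V 0 + κ/2)) -
      ∫ r in (0:ℝ)..1, (V r - (V 0 + κ * r)) := by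
    rw [intervalIntegral.integral_sub iM iV, intervalIntegral.integral_sub iM iA,
      intervalIntegral.integral_sub iV il, il2]; ring
  have hρ : 0 ≤ 180 * S.C ^ 7 * ε ^ 2 := by positivity
  have b1 := int_MM_diff S.hum (hκδ.trans hδu) hρ zero_le_one le_rfl P.Vm.measurable hV
  have b1' := intervalIntegral.norm_integral_le_integral_norm (μ := volume)
    (f := fun r => MM S.um (V r) r - MM S.um (V 0 + κ * r) r) (zero_le_one (α := ℝ))
  simp only [Real.norm_eq_abs] at b1'
  have b2 := int_MM_aff_approx S.hδ.le S.hum hv0 hκδ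
  have b3 := intervalIntegral.norm_integral_le_of_norm_le_const (a := 0) (b := 1)
    (C := 180 * S.C ^ 7 * ε ^ 2) (f := fun r => V r - (V 0 + κ * r)) (fun r hr => by
      rw [Set.uIoc_of_le zero_le_one] at hr
      exact hV r ⟨hr.1.le, hr.2⟩)
  simp only [Real.norm_eq_abs, sub_zero, abs_one, mul_one] at b3
  have b4 : 4 / S.um * κ^2 ≤ 16 * S.C ^ 8 / S.um * ε^2 := by
    have : κ^2 ≤ (ε * (2 * S.C ^ 4))^2 := by
      rw [← sq_abs]; gcongr
    calc _ ≤ 4 / S.um * (ε * (2 * S.C ^ 4))^2 := by gcongr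
      _ = _ := by ring
  rw [e]
  refine (abs_sub _ _).trans ((add_le_add_left (abs_add_le _ _) _).trans ?_)
  linarith

lemma tayXZ {φ : E → E} {D : E → E →L[ℝ] E} (hφ : Nice S.C φ D)
    (P : S.Per ε T b X N Zr V) {σ : ℝ} (hσ : σ ∈ Set.Icc 0 b) :
    ‖φ (X σ) - φ (Zr σ) - D (X 0) (X σ - Zr σ)‖ ≤ 52 * S.C ^ 5 * ε ^ 2 := by
  have h0 := P.e0
  have hC := S.C0
  have e : φ (X σ) - φ (Zr σ) - D (X 0) (X σ - Zr σ) = (φ (X σ) - φ (X 0) - D (X 0) (X σ - X 0)) -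
    (φ (Zr σ) - φ (X 0) - D (X 0) (Zr σ - X 0)) := by
    simp only [map_sub]; abel
  rw [e]
  have b1 := P.bX hσ
  have b2 := P.bZ hσ
  calc _ ≤ S.C * ‖X σ - X 0‖^2 + S.C * ‖Zr σ - X 0‖^2 :=
        (norm_sub_le _ _).trans (add_le_add (hφ.tay _ _) (hφ.tay _ _))
    _ ≤ S.C * (4 * S.C ^ 2 * ε)^2 + S.C * (6 * S.C ^ 2 * ε)^2 := by gcongr
    _ = _ := by ring

lemma norm_smul_le' {c : ℝ} {x : E} {a b : ℝ} (hc : |c| ≤ a) (hx : ‖x‖ ≤ b) : ‖c • x‖ ≤ a * b := by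
  rw [norm_smul]
  exact mul_le_mul hc hx (norm_nonneg _) ((abs_nonneg _).trans hc)

lemma pointwise (P : S.Per ε T b X N Zr V) {r : ℝ} (hr : r ∈ Set.Icc 0 b) :
    ‖(S.f (X r) + MM S.um (V r) r • S.g (X r)) - S.Fd ε (N r) (Zr r) (T + ε * r) -
      (SS S.um (V 0) r • (ε • (S.Df (X 0) (S.g (X 0)) + V 0 • S.Dg (X 0) (S.g (X 0))))
       + (MM S.um (V r) r - V r) • S.g (X 0)
       + ((MM S.um (V 0) r - V 0) * r) • (ε • S.Dg (X 0) (S.f (X 0) + V 0 • S.g (X 0)))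
       + ((MM S.um (V 0) r - V 0) * SS S.um (V 0) r) • (ε • S.Dg (X 0) (S.g (X 0))))‖
    ≤ 504 * S.C ^ 7 * ε ^ 2 + |MM S.um (V r) r - MM S.um (V 0) r| * (4 * S.C ^ 3 * ε) := by
  have h0 := P.e0
  have hC := S.C0
  set w0 := S.f (X 0) + V 0 • S.g (X 0) with hw0
  have hw : ‖w0‖ ≤ 2 * S.C ^ 2 := P.w0_bdd
  set mV := MM S.um (V r) r with hmV
  set m0 := MM S.um (V 0) r with hm0
  set s := SS S.um (V 0) r with hs
  set g0 := S.g (X 0) with hg0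
  set D := S.Dg (X 0) with hD
  set d := S.Df (X 0) with hd
  have hFd : S.Fd ε (N r) (Zr r) (T + ε * r) = S.f (Zr r) + V r • S.g (Zr r) := by
    rw [Fd, ← P.hV]
  have hr1 : r ≤ 1 := hr.2.trans P.b1
  have n1 : ‖S.f (X r) - S.f (Zr r) - d (X r - Zr r)‖ ≤ 52 * S.C ^ 5 * ε ^ 2 := P.tayXZ S.nf hr
  have n2 : ‖d (X r - Zr r - (ε * s) • g0)‖ ≤ S.C * (16 * S.C ^ 5 * ε ^ 2) :=
    d.le_of_opNorm_le_of_le (S.nf.dbd _) (P.expXZ hr)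
  have hVC : |V r| ≤ S.C := (P.Vabs r).trans S.humC
  have n3 : ‖V r • (S.g (X r) - S.g (Zr r) - D (X r - Zr r))‖ ≤ S.C * (52 * S.C ^ 5 * ε ^ 2) :=
    norm_smul_le' hVC (P.tayXZ S.ng hr)
  have n4 : ‖V r • D (X r - Zr r - (ε * s) • g0)‖ ≤ S.C * (S.C * (16 * S.C ^ 5 * ε ^ 2)) :=
    norm_smul_le' hVC (D.le_of_opNorm_le_of_le (S.ng.dbd _) (P.expXZ hr))
  have hsC : |s| ≤ 2 * S.C := (abs_SS_le S.hum (P.Vabs 0) _).trans (by linarith [S.humC])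
  have hes : |ε * s| ≤ ε * (2 * S.C) := by
    rw [abs_mul, abs_of_pos h0]; gcongr
  have n5 : ‖(V r - V 0) • D ((ε * s) • g0)‖ ≤ (8 * S.C ^ 4 * ε) * (S.C * (ε * (2 * S.C) * S.C)) :=
    norm_smul_le' (P.bV hr) (D.le_of_opNorm_le_of_le (S.ng.dbd _) (norm_smul_le' hes (S.ng.bdd _)))
  have hmm : |mV - V r| ≤ 4 * S.C := by
    have := abs_MM_le S.hum (V r) r
    refine (abs_sub _ _).trans ?_
    have := P.Vabs r
    linarith [S.humC]
  have n6 : ‖(mV - V r) • (S.g (X r) - g0 - D (X r - X 0))‖ ≤ (4 * S.C) * (16 * S.C ^ 5 * ε ^ 2) := by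
    refine norm_smul_le' hmm ((S.ng.tay _ _).trans ?_)
    have b1 := P.bX hr
    calc _ ≤ S.C * (4 * S.C ^ 2 * ε)^2 := by gcongr
      _ = _ := by ring
  have n7 : ‖(mV - V r) • D (X r - X 0 - ε • (r • w0 + s • g0))‖ ≤
      (4 * S.C) * (S.C * (64 * S.C ^ 5 * ε ^ 2)) :=
    norm_smul_le' hmm (D.le_of_opNorm_le_of_le (S.ng.dbd _) (P.expX hr))
  have n8 : ‖((mV - V r) - (m0 - V 0)) • D (ε • (r • w0 + s • g0))‖ ≤
      (|mV - m0| + 8 * S.C ^ 4 * ε) * (S.C * (ε * (1 * (2 * S.C ^ 2) + (2 * S.C) * S.C))) := by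
    refine norm_smul_le' ?_ (D.le_of_opNorm_le_of_le (S.ng.dbd _) (norm_smul_le' (by rw [abs_of_pos h0])
      ((norm_add_le _ _).trans (add_le_add (norm_smul_le' (by rw [abs_of_nonneg hr.1]; exact hr1) hw)
        (norm_smul_le' hsC (S.ng.bdd _))))))
    rw [show (mV - V r) - (m0 - V 0) = (mV - m0) - (V r - V 0) by ring]
    exact (abs_sub _ _).trans (add_le_add_right (P.bV hr) _)
  have e : (S.f (X r) + mV • S.g (X r)) - S.Fd ε (N r) (Zr r) (T + ε * r) -
      (s • (ε • (d g0 + V 0 • D g0)) + (mV - V r) • g0 + ((m0 - V 0) * r) • (ε • D w0)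
       + ((m0 - V 0) * s) • (ε • D g0)) =
      (S.f (X r) - S.f (Zr r) - d (X r - Zr r)) + d (X r - Zr r - (ε * s) • g0) +
      V r • (S.g (X r) - S.g (Zr r) - D (X r - Zr r)) + V r • D (X r - Zr r - (ε * s) • g0) +
      (V r - V 0) • D ((ε * s) • g0) + (mV - V r) • (S.g (X r) - g0 - D (X r - X 0)) +
      (mV - V r) • D (X r - X 0 - ε • (r • w0 + s • g0)) +
      ((mV - V r) - (m0 - V 0)) • D (ε • (r • w0 + s • g0)) := by
    rw [hFd]
    clear_value w0 mV m0 s g0 D d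
    simp only [map_sub, map_add, map_smul]
    module
  rw [e]
  have q1 : S.C ^ 5 ≤ S.C ^ 7 := pow_le_pow_right₀ S.hC (by norm_num)
  have q2 : S.C ^ 6 ≤ S.C ^ 7 := pow_le_pow_right₀ S.hC (by norm_num)
  have hε2 : 0 ≤ ε ^ 2 := by positivity
  have r1 := mul_le_mul_of_nonneg_right q1 hε2
  have r2 := mul_le_mul_of_nonneg_right q2 hε2
  refine (norm_add_le_of_le (norm_add_le_of_le (norm_add_le_of_le (norm_add_le_of_le (norm_add_le_of_le
    (norm_add_le_of_le (norm_add_le_of_le n1 n2) n3) n4) n5) n6) n7) n8).trans ?_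
  have : 52 * S.C ^ 5 * ε ^ 2 + S.C * (16 * S.C ^ 5 * ε ^ 2) + S.C * (52 * S.C ^ 5 * ε ^ 2) +
      S.C * (S.C * (16 * S.C ^ 5 * ε ^ 2)) + 8 * S.C ^ 4 * ε * (S.C * (ε * (2 * S.C) * S.C)) +
      4 * S.C * (16 * S.C ^ 5 * ε ^ 2) + 4 * S.C * (S.C * (64 * S.C ^ 5 * ε ^ 2)) +
      (|mV - m0| + 8 * S.C ^ 4 * ε) * (S.C * (ε * (1 * (2 * S.C ^ 2) + 2 * S.C * S.C))) =
      52 * (S.C ^ 5 * ε ^ 2) + 132 * (S.C ^ 6 * ε ^ 2) + 320 * (S.C ^ 7 * ε ^ 2) +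
        |mV - m0| * (4 * S.C ^ 3 * ε) := by ring
  rw [this]
  linarith

lemma fullBd (P : S.Per ε T 1 X N Zr V) (hε : ε * (2 * S.C ^ 4) ≤ S.δ) :
    ‖X 1 - X 0 - ε • ∫ r in (0:ℝ)..1, S.Fd ε (N r) (Zr r) (T + ε * r)‖ ≤
      (696 * S.C ^ 7 + (1260 * S.C ^ 7 + 16 * S.C ^ 8 / S.um) * S.C) * ε ^ 3 := by
  have h0 := P.e0
  have hC := S.C0
  have z1 := zero_le_one (α := ℝ)
  have iM := ii_MM S.hum P.Vm.measurable z1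
  have iM0 := ii_MM S.hum (measurable_const (a := V 0)) z1
  have iV : IntervalIntegrable V volume 0 1 := ii_of_bdd P.Vm zero_le_one fun r _ => P.Vabs r
  have hM0 : Measurable fun r => MM S.um (V 0) r := measurable_MM _ measurable_const measurable_id
  have hS0 : Measurable fun r => SS S.um (V 0) r := measurable_SS _ measurable_const measurable_id
  set c1 := ε • (S.Df (X 0) (S.g (X 0)) + V 0 • S.Dg (X 0) (S.g (X 0))) with hc1
  set c2 := ε • S.Dg (X 0) (S.f (X 0) + V 0 • S.g (X 0)) with hc2
  set c3 := ε • S.Dg (X 0) (S.g (X 0)) with hc3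
  have j1 := ii_smul_const (ii_SS S.hum (P.Vabs 0) z1) c1
  have j2 := ii_smul_const (iM.sub iV) (S.g (X 0))
  have j3 := ii_smul_const (φ := fun r => (MM S.um (V 0) r - V 0) * r)
    ((iM0.sub intervalIntegrable_const).mul_continuousOn (by fun_prop)) c2
  have j4 : IntervalIntegrable (fun r => ((MM S.um (V 0) r - V 0) * SS S.um (V 0) r) • c3) volume 0 1 := by
    refine ii_smul_const (φ := fun r => (MM S.um (V 0) r - V 0) * SS S.um (V 0) r) ?_ c3
    refine ii_of_bdd ((hM0.sub_const _).mul hS0).stronglyMeasurable z1 (B := (4 * S.um) * (2 * S.um))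
      fun r _ => ?_
    show ‖(MM S.um (V 0) r - V 0) * SS S.um (V 0) r‖ ≤ _
    rw [norm_mul]
    refine mul_le_mul ?_ (abs_SS_le S.hum (P.Vabs 0) _) (norm_nonneg _) (by linarith [S.hum])
    refine (abs_sub _ _).trans ?_
    linarith [P.Vabs 0, abs_MM_le S.hum (V 0) r]
  have jm := ((j1.add j2).add j3).add j4
  have jl := (P.ii_rhs z1).sub (P.ii_Fd z1)
  have emain : ∫ r in (0:ℝ)..1, (SS S.um (V 0) r • c1 + (MM S.um (V r) r - V r) • S.g (X 0)
       + ((MM S.um (V 0) r - V 0) * r) • c2 + ((MM S.um (V 0) r - V 0) * SS S.um (V 0) r) • c3) =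
       (∫ r in (0:ℝ)..1, (MM S.um (V r) r - V r)) • S.g (X 0) := by
    rw [intervalIntegral.integral_add ((j1.add j2).add j3) j4,
      intervalIntegral.integral_add (j1.add j2) j3, intervalIntegral.integral_add j1 j2,
      intervalIntegral.integral_smul_const, intervalIntegral.integral_smul_const,
      intervalIntegral.integral_smul_const, intervalIntegral.integral_smul_const,
      int_SS S.hum (P.Vabs 0), int_s0_id S.hum (P.Vabs 0), int_s0_SS S.hum (P.Vabs 0)]
    simp
  have id : IntervalIntegrable (fun r => |MM S.um (V r) r - MM S.um (V 0) r|) volume 0 1 :=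
    (iM.sub iM0).abs
  have ig : IntervalIntegrable (fun r => 504 * S.C ^ 7 * ε ^ 2 +
      |MM S.um (V r) r - MM S.um (V 0) r| * (4 * S.C ^ 3 * ε)) volume 0 1 :=
    IntervalIntegrable.add intervalIntegrable_const (id.mul_const _)
  have key := intervalIntegral.norm_integral_le_of_norm_le z1 (μ := volume)
    (f := fun r => (S.f (X r) + MM S.um (V r) r • S.g (X r)) - S.Fd ε (N r) (Zr r) (T + ε * r) -
      (SS S.um (V 0) r • c1 + (MM S.um (V r) r - V r) • S.g (X 0)
       + ((MM S.um (V 0) r - V 0) * r) • c2 + ((MM S.um (V 0) r - V 0) * SS S.um (V 0) r) • c3))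
    (ae_of_all _ fun r hr => P.pointwise ⟨hr.1.le, hr.2⟩) ig
  rw [int_aff id, intervalIntegral.integral_sub jl jm, emain] at key
  have e : X 1 - X 0 - ε • ∫ r in (0:ℝ)..1, S.Fd ε (N r) (Zr r) (T + ε * r) =
      ε • ∫ r in (0:ℝ)..1, ((S.f (X r) + MM S.um (V r) r • S.g (X r)) - S.Fd ε (N r) (Zr r) (T + ε * r)) := by
    rw [intervalIntegral.integral_sub (P.ii_rhs z1) (P.ii_Fd z1), P.eX 1 ⟨z1, le_rfl⟩]
    module
  rw [e, norm_smul, Real.norm_eq_abs, abs_of_pos h0]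
  set I := ∫ r in (0:ℝ)..1, ((S.f (X r) + MM S.um (V r) r • S.g (X r)) - S.Fd ε (N r) (Zr r) (T + ε * r))
  set J := ∫ r in (0:ℝ)..1, (MM S.um (V r) r - V r) with hJ
  have hJb := P.s0_mean hε
  have b2 : ‖J • S.g (X 0)‖ ≤ (1260 * S.C ^ 7 + 16 * S.C ^ 8 / S.um) * ε ^ 2 * S.C :=
    norm_smul_le' hJb (S.ng.bdd _)
  have b3 := P.int_diff (σ := 1) ⟨z1, le_rfl⟩
  have b4 : ‖I‖ ≤ ‖I - J • S.g (X 0)‖ + ‖J • S.g (X 0)‖ := by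
    simpa using norm_add_le (I - J • S.g (X 0)) (J • S.g (X 0))
  have b5 : ‖I‖ ≤ 1 * (504 * S.C ^ 7 * ε ^ 2) + (48 * S.C ^ 4 * ε) * (4 * S.C ^ 3 * ε) +
      (1260 * S.C ^ 7 + 16 * S.C ^ 8 / S.um) * ε ^ 2 * S.C := by
    refine b4.trans (add_le_add (key.trans ?_) b2)
    gcongr
  calc _ ≤ ε * _ := mul_le_mul_of_nonneg_left b5 h0.le
    _ = _ := by ring

end Per
end Sys
end
end PWM
open MeasureTheory
namespace PWM
noncomputable section

lemma gron {φ : ℝ → ℝ} (hI : ∀ a b, IntervalIntegrable φ volume a b) {Λ A L : ℝ}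
    (hΛ : 0 ≤ Λ) (hA : 0 ≤ A) (hφ0 : ∀ t, 0 ≤ φ t)
    (h : ∀ t ∈ Set.Icc 0 L, φ t ≤ A + Λ * ∫ s in (0:ℝ)..t, φ s) :
    ∀ t ∈ Set.Icc 0 L, φ t ≤ A * Real.exp (Λ * t) := by
  set ψ : ℝ → ℝ := fun t => A + Λ * ∫ s in (0:ℝ)..t, φ s with hψ
  have hψc : Continuous ψ :=
    continuous_const.add (continuous_const.mul (intervalIntegral.continuous_primitive hI 0))
  set Ψ : ℝ → ℝ := fun t => A + Λ * ∫ s in (0:ℝ)..t, ψ s with hΨ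
  have hd : ∀ t, HasDerivAt Ψ (Λ * ψ t) t := fun t =>
    ((intervalIntegral.integral_hasDerivAt_right (hψc.intervalIntegrable _ _)
      (hψc.stronglyMeasurableAtFilter _ _) hψc.continuousAt).const_mul Λ).const_add A
  have hΨc : Continuous Ψ := continuous_iff_continuousAt.2 fun t => (hd t).continuousAt
  have hle : ∀ t ∈ Set.Icc 0 L, ψ t ≤ Ψ t := by
    intro t ht
    simp only [hψ, hΨ]
    gcongr
    refine intervalIntegral.integral_mono_on ht.1 (hI _ _) (hψc.intervalIntegrable _ _) fun s hs => ?_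
    exact h s ⟨hs.1, hs.2.trans ht.2⟩
  have hψ0 : ∀ t ∈ Set.Icc 0 L, 0 ≤ ψ t := fun t ht => by
    have : 0 ≤ ∫ s in (0:ℝ)..t, φ s := intervalIntegral.integral_nonneg ht.1 fun s _ => hφ0 s
    simp only [hψ]; positivity
  have key := norm_le_gronwallBound_of_norm_deriv_right_le (f := Ψ) (f' := fun t => Λ * ψ t)
    (δ := A) (K := Λ) (ε := 0) (a := 0) (b := L) hΨc.continuousOn
    (fun t _ => (hd t).hasDerivWithinAt) (by simp [hΨ, abs_of_nonneg hA]) (fun t ht => by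
      have ht' : t ∈ Set.Icc 0 L := ⟨ht.1, ht.2.le⟩
      rw [add_zero, norm_mul, Real.norm_eq_abs, abs_of_nonneg hΛ, Real.norm_eq_abs,
        abs_of_nonneg (hψ0 t ht')]
      gcongr
      exact (hle t ht').trans (le_abs_self _))
  intro t ht
  have := key t ht
  rw [gronwallBound_ε0, sub_zero] at this
  exact (h t ht).trans ((hle t ht).trans ((le_abs_self _).trans this))

variable {E F : Type*} [NormedAddCommGroup E] [NormedSpace ℝ E] [CompleteSpace E]
  [NormedAddCommGroup F] [NormedSpace ℝ F] [CompleteSpace F]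
namespace Sys
variable (S : Sys E F)

/-- solution on the whole horizon -/
structure Glob (ε L : ℝ) (x : ℝ → E) (η : ℝ → F) (z : ℝ → E) (v : ℝ → ℝ) : Prop where
  e0 : 0 < ε
  e1 : ε ≤ 1
  e2 : ε * (2 * S.C ^ 4) ≤ S.δ
  xc : Continuous x
  ηc : Continuous η
  hz : ∀ t, z t = S.Z ε (η t) (x t) t (t/ε)
  hv : ∀ t, v t = S.A ε (η t) (z t) t
  ex : ∀ t ∈ Set.Icc 0 L, x t = x 0 + ∫ s in (0:ℝ)..t, (S.f (x s) + MM S.um (v s) (s/ε) • S.g (x s))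
  eη : ∀ t ∈ Set.Icc 0 L, η t = η 0 + ∫ s in (0:ℝ)..t, S.B ε (η s) (z s) s

/-- one-period constant -/
def K6 : ℝ := 696 * S.C ^ 7 + (1260 * S.C ^ 7 + 16 * S.C ^ 8 / S.um) * S.C

lemma K6_nonneg : 0 ≤ S.K6 := by
  have := S.C0
  have := S.hum
  unfold K6; positivity

variable {S}
namespace Glob
variable {ε L : ℝ} {x : ℝ → E} {η : ℝ → F} {z : ℝ → E} {v : ℝ → ℝ}

lemma zm (G : S.Glob ε L x η z v) : StronglyMeasurable z := by
  rw [show z = _ from funext G.hz]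
  exact S.Z_meas ε G.ηc.stronglyMeasurable G.xc.stronglyMeasurable
    continuous_id.stronglyMeasurable (measurable_id.div_const _)

lemma vm (G : S.Glob ε L x η z v) : StronglyMeasurable v := by
  rw [show v = _ from funext G.hv]
  exact S.A_meas ε G.ηc.stronglyMeasurable G.zm continuous_id.stronglyMeasurable

lemma ii_rhs (G : S.Glob ε L x η z v) {a b : ℝ} (hab : a ≤ b) :
    IntervalIntegrable (fun r => S.f (x r) + MM S.um (v r) (r/ε) • S.g (x r)) volume a b := by
  have hm : StronglyMeasurable fun r => MM S.um (v r) (r/ε) :=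
    (measurable_MM _ G.vm.measurable (measurable_id.div_const _)).stronglyMeasurable
  refine ii_of_bdd (((S.nf.cont.comp G.xc).stronglyMeasurable).add
    (hm.smul (S.ng.cont.comp G.xc).stronglyMeasurable)) (B := S.C + 3 * S.um * S.C) hab fun r _ => ?_
  refine (norm_add_le _ _).trans (add_le_add (S.nf.bdd _) ?_)
  show ‖MM S.um (v r) (r/ε) • S.g (x r)‖ ≤ _
  rw [norm_smul]
  exact mul_le_mul (abs_MM_le S.hum _ _) (S.ng.bdd _) (norm_nonneg _) (by linarith [S.hum])

lemma ii_B (G : S.Glob ε L x η z v) {a b : ℝ} (hab : a ≤ b) :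
    IntervalIntegrable (fun r => S.B ε (η r) (z r) r) volume a b :=
  ii_of_bdd (S.B_meas ε G.ηc.stronglyMeasurable G.zm continuous_id.stronglyMeasurable) hab
    fun _ _ => S.ab _

lemma ii_Fd (G : S.Glob ε L x η z v) {a b : ℝ} (hab : a ≤ b) :
    IntervalIntegrable (fun r => S.Fd ε (η r) (z r) r) volume a b :=
  ii_of_bdd (S.Fd_meas ε G.ηc.stronglyMeasurable G.zm continuous_id.stronglyMeasurable) hab
    fun _ _ => S.Fd_bdd _ _ _ _

lemma per (G : S.Glob ε L x η z v) (k : ℕ) {b : ℝ} (hb0 : 0 ≤ b) (hb1 : b ≤ 1)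
    (hb : k * ε + ε * b ≤ L) :
    S.Per ε (k * ε) b (fun r => x (k * ε + ε * r)) (fun r => η (k * ε + ε * r))
      (fun r => z (k * ε + ε * r)) (fun r => v (k * ε + ε * r)) := by
  have h0 := G.e0
  have hdiv : ∀ r : ℝ, (k * ε + ε * r) / ε = k + r := fun r => by field_simp
  have hk0 : 0 ≤ k * ε := by positivity
  have hk : ∀ σ ∈ Set.Icc 0 b, 0 ≤ ε * σ ∧ k * ε + ε * σ ∈ Set.Icc 0 L := fun σ hσ => by
    have h1 := mul_nonneg h0.le hσ.1
    have h2 := mul_le_mul_of_nonneg_left hσ.2 h0.le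
    exact ⟨h1, by linarith, by linarith⟩
  have hk00 : (k:ℝ) * ε ∈ Set.Icc 0 L := by simpa using (hk 0 ⟨le_rfl, hb0⟩).2
  refine ⟨h0, G.e1, hb0, hb1, G.xc.comp (by fun_prop), G.ηc.comp (by fun_prop), fun r => ?_,
    fun r => ?_, fun σ hσ => ?_, fun σ hσ => ?_⟩
  · rw [G.hz, hdiv, Z, Z, SS_add_nat]
  · rw [G.hv]
  · obtain ⟨h1, h2⟩ := hk σ hσ
    have e := intervalIntegral.smul_integral_comp_add_mul (a := 0) (b := σ)
      (fun s => S.f (x s) + MM S.um (v s) (s/ε) • S.g (x s)) ε (k * ε)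
    simp only [hdiv, MM_add_nat, mul_zero, add_zero] at e
    simp only [mul_zero, add_zero]
    rw [e, G.ex _ h2, G.ex _ hk00, ← intervalIntegral.integral_add_adjacent_intervals
      (G.ii_rhs hk0) (G.ii_rhs (a := k * ε) (b := k * ε + ε * σ) (by linarith))]
    abel
  · obtain ⟨h1, h2⟩ := hk σ hσ
    have e := intervalIntegral.smul_integral_comp_add_mul (a := 0) (b := σ)
      (fun s => S.B ε (η s) (z s) s) ε (k * ε)
    simp only [mul_zero, add_zero] at e
    simp only [mul_zero, add_zero]
    rw [e, G.eη _ h2, G.eη _ hk00, ← intervalIntegral.integral_add_adjacent_intervals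
      (G.ii_B hk0) (G.ii_B (a := k * ε) (b := k * ε + ε * σ) (by linarith))]
    abel

lemma steps (G : S.Glob ε L x η z v) (k : ℕ) : k * ε ≤ L →
    ‖x (k * ε) - x 0 - ∫ s in (0:ℝ)..(k * ε), S.Fd ε (η s) (z s) s‖ ≤ k * (S.K6 * ε ^ 3) := by
  have h0 := G.e0
  induction k with
  | zero => intro _; simp
  | succ k ih =>
    intro hk
    push_cast at hk ⊢
    have hk' : k * ε ≤ L := by linarith
    have hk0 : 0 ≤ k * ε := by positivity
    have P := G.per k zero_le_one le_rfl (by linarith)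
    have b1 := P.fullBd G.e2
    have e := intervalIntegral.smul_integral_comp_add_mul (a := 0) (b := 1)
      (fun s => S.Fd ε (η s) (z s) s) ε (k * ε)
    rw [e] at b1
    simp only [mul_zero, add_zero, mul_one] at b1
    have i1 := G.ii_Fd hk0
    have i2 := G.ii_Fd (a := k * ε) (b := k * ε + ε) (by linarith)
    rw [show ((k:ℝ) + 1) * ε = k * ε + ε by ring,
      ← intervalIntegral.integral_add_adjacent_intervals i1 i2]
    set I1 := ∫ s in (0:ℝ)..(k * ε), S.Fd ε (η s) (z s) s
    set I2 := ∫ s in (k * ε)..(k * ε + ε), S.Fd ε (η s) (z s) s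
    have : x (k * ε + ε) - x 0 - (I1 + I2) = (x (k * ε) - x 0 - I1) + (x (k * ε + ε) - x (k * ε) - I2) := by
      abel
    rw [this]
    refine (norm_add_le_of_le (ih hk') b1).trans (le_of_eq ?_)
    unfold K6; ring

lemma z0 (G : S.Glob ε L x η z v) : z 0 = x 0 := by
  rw [G.hz, Z, zero_div, SS_zero]; simp

lemma zint (G : S.Glob ε L x η z v) {t : ℝ} (ht : t ∈ Set.Icc 0 L) :
    ‖z t - x 0 - ∫ s in (0:ℝ)..t, S.Fd ε (η s) (z s) s‖ ≤ (L * S.K6 + 104 * S.C ^ 6) * ε ^ 2 := by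
  have h0 := G.e0
  have hte : 0 ≤ t / ε := div_nonneg ht.1 h0.le
  set k := ⌊t/ε⌋₊ with hk
  set b := t/ε - k with hb
  have hkl : (k:ℝ) ≤ t/ε := Nat.floor_le hte
  have hb0 : 0 ≤ b := by linarith
  have hb1 : b ≤ 1 := by linarith [Nat.lt_floor_add_one (t/ε)]
  have hkt : k * ε + ε * b = t := by rw [hb]; field_simp; ring
  have hk0 : 0 ≤ k * ε := by positivity
  have hkL : k * ε ≤ t := by nlinarith
  have P := G.per k hb0 hb1 (by rw [hkt]; exact ht.2)
  have b1 := P.partialBd (σ := b) ⟨hb0, le_rfl⟩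
  have e := intervalIntegral.smul_integral_comp_add_mul (a := 0) (b := b)
      (fun s => S.Fd ε (η s) (z s) s) ε (k * ε)
  rw [e] at b1
  simp only [mul_zero, add_zero, hkt] at b1
  have b2 := G.steps k (hkL.trans ht.2)
  rw [← intervalIntegral.integral_add_adjacent_intervals (G.ii_Fd hk0) (G.ii_Fd hkL)]
  set I1 := ∫ s in (0:ℝ)..(k * ε), S.Fd ε (η s) (z s) s
  set I2 := ∫ s in (k * ε)..t, S.Fd ε (η s) (z s) s
  have : z t - x 0 - (I1 + I2) = (x (k * ε) - x 0 - I1) + (z t - x (k * ε) - I2) := by abel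
  rw [this]
  refine (norm_add_le_of_le b2 b1).trans ?_
  have hK := S.K6_nonneg
  have : k * (S.K6 * ε ^ 3) ≤ L * S.K6 * ε^2 := by
    calc _ = (k * ε) * (S.K6 * ε ^ 2) := by ring
      _ ≤ L * (S.K6 * ε ^ 2) := by gcongr; exact hkL.trans ht.2
      _ = _ := by ring
  linarith

variable {xb : ℝ → E} {ηb : ℝ → F}

lemma compare (G : S.Glob ε L x η z v) (hL : 0 ≤ L) (hxc : Continuous xb) (hηc : Continuous ηb)
    (hx0 : xb 0 = x 0) (hη0 : ηb 0 = η 0)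
    (hxb : ∀ t ∈ Set.Icc 0 L, xb t = xb 0 + ∫ s in (0:ℝ)..t, S.Fd ε (ηb s) (xb s) s)
    (hηb : ∀ t ∈ Set.Icc 0 L, ηb t = ηb 0 + ∫ s in (0:ℝ)..t, S.B ε (ηb s) (xb s) s)
    {t : ℝ} (ht : t ∈ Set.Icc 0 L) :
    ‖z t - xb t‖ + ‖η t - ηb t‖ ≤
      (L * S.K6 + 104 * S.C ^ 6) * Real.exp ((4 * S.C ^ 3 + S.C ^ 3) * L) * ε ^ 2 := by
  have h0 := G.e0
  have hC := S.C0
  have hK := S.K6_nonneg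
  set φ : ℝ → ℝ := fun t => ‖z t - xb t‖ + ‖η t - ηb t‖ with hφ
  have hφm : StronglyMeasurable φ :=
    (G.zm.sub hxc.stronglyMeasurable).norm.add (G.ηc.sub hηc).norm.stronglyMeasurable
  have hI : ∀ a b, IntervalIntegrable φ volume a b := fun a b => by
    have hc : Continuous fun s => 2 * S.C ^ 2 * ε + ‖x s - xb s‖ + ‖η s - ηb s‖ := by
      have := G.xc; have := G.ηc; fun_prop
    refine (hc.intervalIntegrable a b).mono_fun' hφm.aestronglyMeasurable (ae_of_all _ fun s => ?_)
    have h1 := S.Z_sub_le h0.le (η s) (x s) s (s/ε)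
    rw [← G.hz] at h1
    have h2 : ‖z s - xb s‖ ≤ ‖z s - x s‖ + ‖x s - xb s‖ := norm_sub_le_norm_sub_add_norm_sub _ _ _
    show ‖φ s‖ ≤ 2 * S.C ^ 2 * ε + ‖x s - xb s‖ + ‖η s - ηb s‖
    rw [Real.norm_eq_abs, abs_of_nonneg (add_nonneg (norm_nonneg _) (norm_nonneg _))]
    linarith
  have p2 : S.C ^ 2 ≤ S.C ^ 3 := pow_le_pow_right₀ S.hC (by norm_num)
  have p1 : S.C ≤ S.C ^ 3 := le_self_pow₀ S.hC (by norm_num)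
  have key := gron hI (Λ := 4 * S.C ^ 3 + S.C^3) (A := (L * S.K6 + 104 * S.C ^ 6) * ε ^ 2) (L := L)
    (by positivity) (by positivity) (fun _ => by positivity) (fun t ht => by
      have iF : IntervalIntegrable (fun s => S.Fd ε (ηb s) (xb s) s) volume 0 t :=
        ii_of_bdd (S.Fd_meas ε hηc.stronglyMeasurable hxc.stronglyMeasurable
          continuous_id.stronglyMeasurable) ht.1 fun _ _ => S.Fd_bdd _ _ _ _
      have iB : IntervalIntegrable (fun s => S.B ε (ηb s) (xb s) s) volume 0 t :=
        ii_of_bdd (S.B_meas ε hηc.stronglyMeasurable hxc.stronglyMeasurable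
          continuous_id.stronglyMeasurable) ht.1 fun _ _ => S.ab _
      have e1 : z t - xb t = (z t - x 0 - ∫ s in (0:ℝ)..t, S.Fd ε (η s) (z s) s) +
          ∫ s in (0:ℝ)..t, (S.Fd ε (η s) (z s) s - S.Fd ε (ηb s) (xb s) s) := by
        rw [intervalIntegral.integral_sub (G.ii_Fd ht.1) iF, hxb t ht, hx0]; abel
      have e2 : η t - ηb t = ∫ s in (0:ℝ)..t, (S.B ε (η s) (z s) s - S.B ε (ηb s) (xb s) s) := by
        rw [intervalIntegral.integral_sub (G.ii_B ht.1) iB, hηb t ht, hη0, G.eη t ht]; abel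
      have b1 := intervalIntegral.norm_integral_le_of_norm_le ht.1 (μ := volume)
        (f := fun s => S.Fd ε (η s) (z s) s - S.Fd ε (ηb s) (xb s) s)
        (g := fun s => 3 * S.C ^ 3 * φ s) (ae_of_all _ fun s _ => by
          refine (S.Fd_lip h0.le G.e1 _ _ _ _ _ _).trans (le_of_eq ?_)
          simp only [hφ, sub_self, abs_zero, add_zero]; ring) ((hI 0 t).const_mul _)
      have b2 := intervalIntegral.norm_integral_le_of_norm_le ht.1 (μ := volume)
        (f := fun s => S.B ε (η s) (z s) s - S.B ε (ηb s) (xb s) s)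
        (g := fun s => 2 * S.C ^ 3 * φ s) (ae_of_all _ fun s _ => by
          refine (S.B_lip h0.le G.e1 _ _ _ _ _ _).trans ?_
          have n1 := norm_nonneg (η s - ηb s)
          have n2 := norm_nonneg (z s - xb s)
          simp only [hφ, sub_self, abs_zero, add_zero]
          have r1 := mul_le_mul_of_nonneg_right p1 n1
          have r2 := mul_le_mul_of_nonneg_right p2 n2
          have r3 : 0 ≤ S.C^3 * ‖η s - ηb s‖ := by positivity
          have r4 : 0 ≤ S.C^3 * ‖z s - xb s‖ := by positivity
          nlinarith) ((hI 0 t).const_mul _)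
      rw [intervalIntegral.integral_const_mul] at b1 b2
      have b3 := G.zint ht
      have n1 : ‖z t - xb t‖ ≤ (L*S.K6+104*S.C^6)*ε^2 + 3*S.C^3 * ∫ s in (0:ℝ)..t, φ s := by rw [e1]; exact norm_add_le_of_le b3 b1
      have n2 : ‖η t - ηb t‖ ≤ 2*S.C^3 * ∫ s in (0:ℝ)..t, φ s := by rw [e2]; exact b2
      show ‖z t - xb t‖ + ‖η t - ηb t‖ ≤ _
      linarith)
  have := key t ht
  refine this.trans ?_
  have h1 : Real.exp ((4 * S.C ^ 3 + S.C ^ 3) * t) ≤ Real.exp ((4 * S.C ^ 3 + S.C ^ 3) * L) := by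
    apply Real.exp_le_exp.2
    exact mul_le_mul_of_nonneg_left ht.2 (by positivity)
  calc _ ≤ (L * S.K6 + 104 * S.C ^ 6) * ε ^ 2 * Real.exp ((4 * S.C ^ 3 + S.C ^ 3) * L) :=
        mul_le_mul_of_nonneg_left h1 (by positivity)
    _ = _ := by ring

/-- comparison constant -/
def _root_.PWM.Sys.K7 (S : Sys E F) (L : ℝ) : ℝ :=
  (L * S.K6 + 104 * S.C ^ 6) * Real.exp ((4 * S.C ^ 3 + S.C ^ 3) * L)
/-- state constant -/
def _root_.PWM.Sys.K8 (S : Sys E F) (L : ℝ) : ℝ :=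
  S.K7 L + (2 * S.C * (S.C * (S.K7 L + 2 * S.C ^ 2)) +
    (S.C * (S.K7 L + S.C * (S.K7 L + 2 * S.C ^ 2))) * S.C)
/-- output constant -/
def _root_.PWM.Sys.K9 (S : Sys E F) (L : ℝ) : ℝ :=
  S.C * (S.K7 L + 2 * S.C ^ 2) ^ 2 + S.C * S.K8 L

lemma final (G : S.Glob ε L x η z v) (hL : 0 ≤ L) (hxc : Continuous xb) (hηc : Continuous ηb)
    (hx0 : xb 0 = x 0) (hη0 : ηb 0 = η 0)
    (hxb : ∀ t ∈ Set.Icc 0 L, xb t = xb 0 + ∫ s in (0:ℝ)..t, S.Fd ε (ηb s) (xb s) s)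
    (hηb : ∀ t ∈ Set.Icc 0 L, ηb t = ηb 0 + ∫ s in (0:ℝ)..t, S.B ε (ηb s) (xb s) s)
    {t : ℝ} (ht : t ∈ Set.Icc 0 L) :
    ‖x t - xb t - (ε * SS S.um (S.A ε (ηb t) (xb t) t) (t/ε)) • S.g (xb t)‖ ≤ S.K8 L * ε ^ 2 ∧
    ‖η t - ηb t‖ ≤ S.K7 L * ε ^ 2 ∧
    |S.h (x t) - S.h (xb t) - ε * S.Dh (xb t) (S.g (xb t)) *
      SS S.um (S.A ε (ηb t) (xb t) t) (t/ε)| ≤ S.K9 L * ε ^ 2 := by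
  have h0 := G.e0
  have hC := S.C0
  have hK := S.K6_nonneg
  have hK7 : 0 ≤ S.K7 L := by unfold K7; positivity
  have c := G.compare hL hxc hηc hx0 hη0 hxb hηb ht
  change _ ≤ S.K7 L * ε ^ 2 at c
  have cz : ‖z t - xb t‖ ≤ S.K7 L * ε ^ 2 := by linarith [norm_nonneg (η t - ηb t)]
  have cη : ‖η t - ηb t‖ ≤ S.K7 L * ε ^ 2 := by linarith [norm_nonneg (z t - xb t)]
  have hee : ε ^ 2 ≤ ε := by nlinarith [G.e1]
  have hKe : S.K7 L * ε ^ 2 ≤ S.K7 L * ε := mul_le_mul_of_nonneg_left hee hK7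
  have zx := S.Z_sub_le h0.le (η t) (x t) t (t/ε)
  rw [← G.hz] at zx
  have cx : ‖x t - xb t‖ ≤ (S.K7 L + 2 * S.C ^ 2) * ε := by
    have := norm_sub_le_norm_sub_add_norm_sub (x t) (z t) (xb t)
    rw [norm_sub_rev (x t) (z t)] at this
    linarith
  set U := S.A ε (η t) (x t) t with hU
  set Ub := S.A ε (ηb t) (xb t) t with hUb
  have cu : |SS S.um U (t/ε) - SS S.um Ub (t/ε)| ≤
      S.C * (S.K7 L + S.C * (S.K7 L + 2 * S.C ^ 2)) * ε := by
    refine (SS_lip S.hum _ _ _).trans ((S.A_lip h0.le G.e1 _ _ _ _ _ _).trans ?_)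
    rw [sub_self, abs_zero, add_zero]
    calc _ ≤ S.C * (S.K7 L * ε + S.C * ((S.K7 L + 2 * S.C ^ 2) * ε)) := by
          gcongr; exact cη.trans hKe
      _ = _ := by ring
  have cg : ‖S.g (x t) - S.g (xb t)‖ ≤ S.C * ((S.K7 L + 2 * S.C ^ 2) * ε) :=
    (S.ng.lip _ _).trans (by gcongr)
  have e1 : x t - xb t - (ε * SS S.um Ub (t/ε)) • S.g (xb t) = (z t - xb t) +
      ε • (SS S.um U (t/ε) • (S.g (x t) - S.g (xb t)) +
        (SS S.um U (t/ε) - SS S.um Ub (t/ε)) • S.g (xb t)) := by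
    rw [G.hz, Z, ← hU]; module
  have r1 : ‖x t - xb t - (ε * SS S.um Ub (t/ε)) • S.g (xb t)‖ ≤ S.K8 L * ε ^ 2 := by
    rw [e1]
    have b1 := Per.norm_smul_le' (S.SS_abs ε (η t) (x t) t (t/ε)) cg
    have b2 := Per.norm_smul_le' cu (S.ng.bdd (xb t))
    have b3 := Per.norm_smul_le' (abs_of_pos h0).le (norm_add_le_of_le b1 b2)
    refine (norm_add_le_of_le cz b3).trans (le_of_eq ?_)
    unfold K8; ring
  refine ⟨r1, cη, ?_⟩
  have e2 : S.h (x t) - S.h (xb t) - ε * S.Dh (xb t) (S.g (xb t)) * SS S.um Ub (t/ε) =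
      (S.h (x t) - S.h (xb t) - S.Dh (xb t) (x t - xb t)) +
      S.Dh (xb t) (x t - xb t - (ε * SS S.um Ub (t/ε)) • S.g (xb t)) := by
    rw [map_sub (S.Dh (xb t)) (x t - xb t), map_smul, smul_eq_mul]; ring
  rw [e2, ← Real.norm_eq_abs]
  have b1 := S.nh.tay (xb t) (x t)
  have b2 := (S.Dh (xb t)).le_of_opNorm_le_of_le (S.nh.dbd _) r1
  refine (norm_add_le_of_le b1 b2).trans ?_
  have b3 : S.C * ‖x t - xb t‖ ^ 2 ≤ S.C * ((S.K7 L + 2 * S.C ^ 2) * ε) ^ 2 := by gcongr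
  refine (add_le_add_left b3 _).trans (le_of_eq ?_)
  unfold K9; ring

end Glob
end Sys
end
end PWM
open MeasureTheory
namespace PWM
noncomputable section

lemma nice_of {E F : Type*} [NormedAddCommGroup E] [NormedSpace ℝ E] [NormedAddCommGroup F]
    [NormedSpace ℝ F] {φ : E → F} {c : ℝ} (hφ : ContDiff ℝ 2 φ)
    (hb : ∀ i : ℕ, i ≤ 2 → ∀ x, ‖iteratedFDeriv ℝ i φ x‖ ≤ c) :
    Nice c φ (fderiv ℝ φ) ∧ ∀ x y, ‖fderiv ℝ φ x - fderiv ℝ φ y‖ ≤ c * ‖x - y‖ := by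
  have hd : Differentiable ℝ φ := hφ.differentiable (by norm_num)
  have h0 : ∀ x, ‖φ x‖ ≤ c := fun x => by simpa using hb 0 (by norm_num) x
  have h1 : ∀ x, ‖fderiv ℝ φ x‖ ≤ c := fun x => by
    simpa [norm_iteratedFDeriv_one] using hb 1 (by norm_num) x
  have hd1 : ContDiff ℝ 1 (fderiv ℝ φ) := hφ.fderiv_right (by norm_num)
  have h2 : ∀ x, ‖fderiv ℝ (fderiv ℝ φ) x‖ ≤ c := fun x => by
    rw [← norm_iteratedFDeriv_one, norm_iteratedFDeriv_fderiv]
    exact hb 2 le_rfl x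
  have l2 : ∀ x y, ‖fderiv ℝ φ x - fderiv ℝ φ y‖ ≤ c * ‖x - y‖ := fun x y =>
    convex_univ.norm_image_sub_le_of_norm_fderiv_le
      (fun z _ => (hd1.differentiable (by norm_num)) z) (fun z _ => h2 z)
      (Set.mem_univ _) (Set.mem_univ _)
  refine ⟨⟨hφ.continuous, h0, h1, fun x y => convex_univ.norm_image_sub_le_of_norm_fderiv_le
      (fun z _ => hd z) (fun z _ => h1 z) (Set.mem_univ _) (Set.mem_univ _), fun x y => ?_⟩, l2⟩
  have hc : 0 ≤ c := (norm_nonneg _).trans (h0 x)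
  have := (convex_segment (𝕜 := ℝ) x y).norm_image_sub_le_of_norm_hasFDerivWithin_le' (f := φ)
    (f' := fderiv ℝ φ) (φ := fderiv ℝ φ x) (C := c * ‖y - x‖)
    (fun z _ => (hd z).hasFDerivAt.hasFDerivWithinAt) (fun z hz => ?_)
    (left_mem_segment ℝ x y) (right_mem_segment ℝ x y)
  · refine this.trans (le_of_eq ?_); ring
  · refine (l2 z x).trans (mul_le_mul_of_nonneg_left ?_ hc)
    obtain ⟨θ, hθ, rfl⟩ := (segment_eq_image' ℝ x y ▸ hz)
    rw [add_sub_cancel_left, norm_smul, Real.norm_eq_abs, abs_of_nonneg hθ.1]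
    exact mul_le_of_le_one_left (norm_nonneg _) hθ.2

lemma Nice.mono {E F : Type*} [NormedAddCommGroup E] [NormedSpace ℝ E] [NormedAddCommGroup F]
    [NormedSpace ℝ F] {φ : E → F} {D : E → E →L[ℝ] F} {c C : ℝ} (h : Nice c φ D) (hc : c ≤ C) :
    Nice C φ D :=
  ⟨h.cont, fun x => (h.bdd x).trans hc, fun x => (h.dbd x).trans hc,
    fun x y => (h.lip x y).trans (mul_le_mul_of_nonneg_right hc (norm_nonneg _)),
    fun x y => (h.tay x y).trans (mul_le_mul_of_nonneg_right hc (by positivity))⟩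

/-- clamping a time to the horizon -/
def cl (L t : ℝ) : ℝ := max 0 (min t L)

lemma cl_eq {L t : ℝ} (h : t ∈ Set.Icc 0 L) : cl L t = t := by
  rw [cl, min_eq_left h.2, max_eq_right h.1]

lemma cl_mem {L : ℝ} (hL : 0 ≤ L) (t : ℝ) : cl L t ∈ Set.Icc 0 L :=
  ⟨le_max_left _ _, max_le hL (min_le_right _ _)⟩

lemma cl_cont {X : Type*} [TopologicalSpace X] {L : ℝ} (hL : 0 ≤ L) {x : ℝ → X}
    (hx : ContinuousOn x (Set.Icc 0 L)) : Continuous fun t => x (cl L t) :=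
  hx.comp_continuous (by unfold cl; fun_prop) (cl_mem hL)

lemma int_cl {X : Type*} [NormedAddCommGroup X] [NormedSpace ℝ X] {L t : ℝ}
    (ht : t ∈ Set.Icc 0 L) {φ ψ : ℝ → X} (h : ∀ s ∈ Set.Icc 0 L, φ s = ψ s) :
    ∫ s in (0:ℝ)..t, φ s = ∫ s in (0:ℝ)..t, ψ s := by
  refine intervalIntegral.integral_congr fun s hs => ?_
  rw [Set.uIcc_of_le ht.1] at hs
  exact h s ⟨hs.1, hs.2.trans ht.2⟩

end
end PWM

open MeasureTheory

/-- main averaging theorem, finite horizon — Theorem 1 of the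
paper: on `[0, L]`, the PWM-fed closed-loop trajectory equals the averaged
closed-loop trajectory plus the explicit `O(ε)` ripple `ε g(x̄) s₁(ū, t/ε)`,
up to `O(ε²)`; likewise for the controller state and for the measured output,
which acquires the ripple term `ε h'(x̄)g(x̄) · s₁(ū, t/ε)`. -/
theorem pwm_injection_main_averaging_theorem
    {n q : ℕ}
    (u_m δ : ℝ) (hum : 0 < u_m) (hδ : 0 < δ)
    -- PWM sawtooth, modulation function, probing signal and its primitive
    (w : ℝ → ℝ) (hw : ∀ σ : ℝ, w σ = u_m * Int.fract (σ + 1/2) - u_m/2)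
    (Mod : ℝ → ℝ → ℝ)
    (hMod : ∀ v σ : ℝ, Mod v σ =
      u_m + u_m * Real.sign (v - u_m - 4 * w σ) + u_m * Real.sign (v - u_m + 4 * w σ))
    (s₀ : ℝ → ℝ → ℝ) (hs₀ : ∀ v σ : ℝ, s₀ v σ = Mod v σ - v)
    (s₁ : ℝ → ℝ → ℝ)
    (hs₁ : ∀ v σ : ℝ, s₁ v σ =
      (1 - v/u_m) * w σ - |(v - u_m)/4 - w σ| + |(v - u_m)/4 + w σ|)
    -- vector fields and output map: bounded and C³ with bounded derivatives
    (f g : EuclideanSpace ℝ (Fin n) → EuclideanSpace ℝ (Fin n))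
    (h : EuclideanSpace ℝ (Fin n) → ℝ)
    (Cf : ℝ) (hf : ContDiff ℝ 3 f)
    (hfb : ∀ i : ℕ, i ≤ 3 → ∀ x, ‖iteratedFDeriv ℝ i f x‖ ≤ Cf)
    (Cg : ℝ) (hg : ContDiff ℝ 3 g)
    (hgb : ∀ i : ℕ, i ≤ 3 → ∀ x, ‖iteratedFDeriv ℝ i g x‖ ≤ Cg)
    (Ch : ℝ) (hh : ContDiff ℝ 3 h)
    (hhb : ∀ i : ℕ, i ≤ 3 → ∀ x, ‖iteratedFDeriv ℝ i h x‖ ≤ Ch)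
    -- control law: bounded and C² with bounded derivatives, range ≤ u_m − δ
    (α : (EuclideanSpace ℝ (Fin q)) × (ℝ × ℝ) × ℝ → ℝ)
    (a : (EuclideanSpace ℝ (Fin q)) × (ℝ × ℝ) × ℝ → EuclideanSpace ℝ (Fin q))
    (Cα : ℝ) (hα : ContDiff ℝ 2 α)
    (hαb : ∀ i : ℕ, i ≤ 2 → ∀ p, ‖iteratedFDeriv ℝ i α p‖ ≤ Cα)
    (hα_range : ∀ p, |α p| ≤ u_m - δ)
    (Ca : ℝ) (ha : ContDiff ℝ 2 a)
    (hab : ∀ i : ℕ, i ≤ 2 → ∀ p, ‖iteratedFDeriv ℝ i a p‖ ≤ Ca)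
    -- horizon and initial conditions
    (L : ℝ) (hL : 0 < L)
    (x₀ : EuclideanSpace ℝ (Fin n)) (η₀ : EuclideanSpace ℝ (Fin q)) :
    ∃ K : ℝ, 0 < K ∧ ∃ ε₀ : ℝ, 0 < ε₀ ∧
      ∀ ε : ℝ, 0 < ε → ε < ε₀ →
      -- the augmented output map H(x) = (h(x), ε h'(x) g(x))
      ∀ Hf : EuclideanSpace ℝ (Fin n) → ℝ × ℝ,
      (∀ x, Hf x = (h x, ε * (fderiv ℝ h x) (g x))) →
      -- H̄(x, η, σ, t) = H(x − ε g(x) s₁(α(η, H(x), t), σ))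
      ∀ Hb : EuclideanSpace ℝ (Fin n) → EuclideanSpace ℝ (Fin q) → ℝ → ℝ → ℝ × ℝ,
      (∀ x η σ t, Hb x η σ t = Hf (x - (ε * s₁ (α (η, Hf x, t)) σ) • g x)) →
      -- the PWM closed-loop solution (absolutely continuous, in integral form)
      ∀ (x : ℝ → EuclideanSpace ℝ (Fin n)) (η : ℝ → EuclideanSpace ℝ (Fin q)),
      ContinuousOn x (Set.Icc 0 L) → ContinuousOn η (Set.Icc 0 L) →
      x 0 = x₀ → η 0 = η₀ →
      (∀ t ∈ Set.Icc (0:ℝ) L, x t = x₀ + ∫ s in (0:ℝ)..t,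
        (f (x s) + Mod (α (η s, Hb (x s) (η s) (s/ε) s, s)) (s/ε) • g (x s))) →
      (∀ t ∈ Set.Icc (0:ℝ) L, η t = η₀ + ∫ s in (0:ℝ)..t,
        a (η s, Hb (x s) (η s) (s/ε) s, s)) →
      ∀ u : ℝ → ℝ, (∀ t, u t = α (η t, Hf (x t), t)) →
      -- the averaged closed-loop solution with shifted initial condition
      ∀ (xbar : ℝ → EuclideanSpace ℝ (Fin n)) (ηbar : ℝ → EuclideanSpace ℝ (Fin q)),
      ContinuousOn xbar (Set.Icc 0 L) → ContinuousOn ηbar (Set.Icc 0 L) →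
      xbar 0 = x₀ - (ε * s₁ (u 0) 0) • g x₀ → ηbar 0 = η₀ →
      (∀ t ∈ Set.Icc (0:ℝ) L, xbar t = xbar 0 + ∫ s in (0:ℝ)..t,
        (f (xbar s) + α (ηbar s, Hf (xbar s), s) • g (xbar s))) →
      (∀ t ∈ Set.Icc (0:ℝ) L, ηbar t = η₀ + ∫ s in (0:ℝ)..t,
        a (ηbar s, Hf (xbar s), s)) →
      ∀ ubar : ℝ → ℝ, (∀ t, ubar t = α (ηbar t, Hf (xbar t), t)) →
      -- conclusion: ripple expansion of state, controller state and output
      ∀ t ∈ Set.Icc (0:ℝ) L,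
        ‖x t - xbar t - (ε * s₁ (ubar t) (t/ε)) • g (xbar t)‖ ≤ K * ε^2 ∧
        ‖η t - ηbar t‖ ≤ K * ε^2 ∧
        |h (x t) - h (xbar t)
          - ε * (fderiv ℝ h (xbar t)) (g (xbar t)) * s₁ (ubar t) (t/ε)| ≤ K * ε^2 := by
  have hL0 := hL.le
  obtain rfl : w = PWM.ww u_m := funext hw
  obtain rfl : Mod = PWM.MM u_m := funext fun v => funext fun σ => hMod v σ
  obtain rfl : s₁ = PWM.SS u_m := funext fun v => funext fun σ => hs₁ v σ
  obtain ⟨nf, -⟩ := PWM.nice_of (hf.of_le (by norm_num)) fun i hi => hfb i (by omega)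
  obtain ⟨ng, -⟩ := PWM.nice_of (hg.of_le (by norm_num)) fun i hi => hgb i (by omega)
  obtain ⟨nh, lh⟩ := PWM.nice_of (hh.of_le (by norm_num)) fun i hi => hhb i (by omega)
  obtain ⟨nα, -⟩ := PWM.nice_of hα hαb
  obtain ⟨na, -⟩ := PWM.nice_of ha hab
  have pf : 0 ≤ Cf := (norm_nonneg _).trans (nf.bdd 0)
  have pg : 0 ≤ Cg := (norm_nonneg _).trans (ng.bdd 0)
  have ph : 0 ≤ Ch := (norm_nonneg _).trans (nh.bdd 0)
  have pα : 0 ≤ Cα := (norm_nonneg _).trans (nα.bdd 0)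
  have pa : 0 ≤ Ca := (norm_nonneg _).trans (na.bdd 0)
  have phg : 0 ≤ Ch * Cg := mul_nonneg ph pg
  obtain ⟨C, hCd⟩ : ∃ C, C = 1 + u_m + Cf + Cg + Ch + Cα + Ca + 2 * (Ch * Cg) := ⟨_, rfl⟩
  have na' := na.mono (C := C) (by linarith)
  let S : PWM.Sys (EuclideanSpace ℝ (Fin n)) (EuclideanSpace ℝ (Fin q)) :=
    { um := u_m, δ := δ, C := C, f := f, g := g, h := h, Df := fderiv ℝ f, Dg := fderiv ℝ g,
      Dh := fderiv ℝ h, α := α, Dα := fderiv ℝ α, a := a, hum := hum, hδ := hδ,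
      hC := by linarith
      humC := by linarith
      nf := nf.mono (by linarith)
      ng := ng.mono (by linarith)
      nh := nh.mono (by linarith)
      nα := nα.mono (by linarith)
      αr := hα_range
      ac := na'.cont
      ab := na'.bdd
      al := na'.lip
      qc := (hh.continuous_fderiv (by norm_num)).clm_apply hg.continuous
      ql := fun x y => by
        have e : fderiv ℝ h x (g x) - fderiv ℝ h y (g y) =
            (fderiv ℝ h x - fderiv ℝ h y) (g x) + fderiv ℝ h y (g x - g y) := by
          simp
        rw [e, ← Real.norm_eq_abs]
        have b1 := (fderiv ℝ h x - fderiv ℝ h y).le_of_opNorm_le_of_le (lh x y) (ng.bdd x)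
        have b2 := (fderiv ℝ h y).le_of_opNorm_le_of_le (nh.dbd y) (ng.lip x y)
        refine (norm_add_le_of_le b1 b2).trans ?_
        have := mul_le_mul_of_nonneg_right (show 2 * (Ch * Cg) ≤ C by linarith)
          (norm_nonneg (x - y))
        linarith }
  have hC0 : 0 < C := S.C0
  have hK6 := S.K6_nonneg
  have hK7 : 0 ≤ S.K7 L := by
    have := S.C0
    unfold PWM.Sys.K7; positivity
  have hK8 : 0 ≤ S.K8 L := by
    have := S.C0
    unfold PWM.Sys.K8; positivity
  have hK9 : 0 ≤ S.K9 L := by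
    have := S.C0
    unfold PWM.Sys.K9; positivity
  refine ⟨S.K7 L + S.K8 L + S.K9 L + 1, by linarith, min 1 (δ / (2 * C ^ 4)), by positivity, ?_⟩
  intro ε he0 he Hf hHf Hb hHb x η hx hη hx0 hη0 ex eη u hu xb ηb hxb hηb hxb0 hηb0 exb eηb ub hub
    t ht
  have he1 : ε ≤ 1 := (he.trans_le (min_le_left _ _)).le
  have he2 : ε * (2 * C ^ 4) ≤ δ := by
    have := (he.trans_le (min_le_right _ _)).le
    rwa [le_div_iff₀ (by positivity)] at this
  have hHf' : Hf = S.Hf ε := funext hHf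
  subst hHf'
  have h0L : (0:ℝ) ∈ Set.Icc 0 L := ⟨le_rfl, hL0⟩
  have c0 : PWM.cl L 0 = 0 := PWM.cl_eq h0L
  have hxb0' : xb 0 = x 0 := by rw [hxb0, PWM.SS_zero, hx0]; simp
  have G : S.Glob ε L (fun t => x (PWM.cl L t)) (fun t => η (PWM.cl L t))
      (fun t => S.Z ε (η (PWM.cl L t)) (x (PWM.cl L t)) t (t/ε))
      (fun t => S.A ε (η (PWM.cl L t))
        (S.Z ε (η (PWM.cl L t)) (x (PWM.cl L t)) t (t/ε)) t) := by
    refine ⟨he0, he1, he2, PWM.cl_cont hL0 hx, PWM.cl_cont hL0 hη, fun _ => rfl, fun _ => rfl,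
      fun t ht => ?_, fun t ht => ?_⟩
    · simp only [c0, PWM.cl_eq ht]
      rw [ex t ht, hx0]
      congr 1
      refine PWM.int_cl ht fun s hs => ?_
      simp only [PWM.cl_eq hs, hHb]
      rfl
    · simp only [c0, PWM.cl_eq ht]
      rw [eη t ht, hη0]
      congr 1
      refine PWM.int_cl ht fun s hs => ?_
      simp only [PWM.cl_eq hs, hHb]
      rfl
  have key := G.final hL0 (PWM.cl_cont hL0 hxb) (PWM.cl_cont hL0 hηb)
    (by simp only [c0, hxb0']) (by simp only [c0, hηb0, hη0])
    (fun t ht => by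
      simp only [c0, PWM.cl_eq ht]
      rw [exb t ht]
      congr 1
      refine PWM.int_cl ht fun s hs => ?_
      simp only [PWM.cl_eq hs]
      rfl)
    (fun t ht => by
      simp only [c0, PWM.cl_eq ht]
      rw [eηb t ht, hηb0]
      congr 1
      refine PWM.int_cl ht fun s hs => ?_
      simp only [PWM.cl_eq hs]
      rfl) ht
  simp only [PWM.cl_eq ht] at key
  have hub' : ub t = S.A ε (ηb t) (xb t) t := hub t
  rw [hub']
  have hee : 0 ≤ ε ^ 2 := sq_nonneg ε
  obtain ⟨k1, k2, k3⟩ := key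
  refine ⟨k1.trans ?_, k2.trans ?_, k3.trans ?_⟩ <;>
    exact mul_le_mul_of_nonneg_right (by linarith) hee
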